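/- arXiv:1809.05553 — 4 statements merged into one kernel-verified Lean document; each statement's English description precedes it below -/
import Mathlib

section
/- Let f : ℂ → ℂ be an entire function such that f(z) ≠ 0 for all z ∈ ℂ and f'(z) ≠ 1 for all z ∈ ℂ. Then f is constant. -/
section

open Metric Real

/-- A nowhere vanishing entire function has an entire logarithm. -/
theorem exists_exp_eq_of_differentiable {f : ℂ → ℂ} (hf : Differentiable ℂ f)
    (h0 : ∀ z, f z ≠ 0) : ∃ g : ℂ → ℂ, Differentiable ℂ g ∧ ∀ z, Complex.exp (g z) = f z := by
  have hd : Differentiable ℂ (deriv f) := hf.contDiff.differentiable_deriv_two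
  have hq : Differentiable ℂ (fun z ↦ deriv f z / f z) := hd.div hf h0
  obtain ⟨g, hg0, hg⟩ := hq.isExactOn_univ.with_val_at 0 (Complex.log (f 0))
  replace hg := fun z ↦ hg z (Set.mem_univ z)
  refine ⟨g, fun z ↦ (hg z).differentiableAt, fun z ↦ ?_⟩
  have hderiv (z) : HasDerivAt (fun z ↦ f z * Complex.exp (-g z)) 0 z := by
    convert! (hf z).hasDerivAt.mul (hg z).neg.cexp using 1
    field_simp [h0 z]
    ring
  have hconst := is_const_of_deriv_eq_zero (fun z ↦ (hderiv z).differentiableAt)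
    (fun z ↦ (hderiv z).deriv) z 0
  simp only [hg0, Complex.exp_neg, Complex.exp_log (h0 0), mul_inv_cancel₀ (h0 0)] at hconst
  field_simp at hconst
  exact hconst.symm

/-- The lower bound contained in Jensen's formula. -/
theorem log_norm_trailingCoeff_le_circleAverage {F : ℂ → ℂ}
    (hF : Differentiable ℂ F) {R : ℝ} (hR : 1 ≤ R) :
    log ‖meromorphicTrailingCoeffAt F 0‖ ≤ circleAverage (log ‖F ·‖) 0 R := by
  have hA : AnalyticOnNhd ℂ F (closedBall 0 |R|) := fun z _ ↦ hF.analyticAt z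
  have hnonneg (u : ℂ) : (0 : ℝ) ≤ MeromorphicOn.divisor F (closedBall 0 |R|) u := by
    exact_mod_cast MeromorphicOn.AnalyticOnNhd.divisor_nonneg hA u
  rw [hA.meromorphicOn.circleAverage_log_norm (by positivity)]
  have h1 : 0 ≤ ∑ᶠ u, (MeromorphicOn.divisor F (closedBall 0 |R|) u : ℝ)
      * log (R * ‖0 - u‖⁻¹) := by
    refine finsum_nonneg fun u ↦ ?_
    by_cases hu : u ∈ closedBall (0 : ℂ) |R|
    · refine mul_nonneg (hnonneg u) ?_
      rcases eq_or_ne u 0 with rfl | hu0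
      · simp
      · refine log_nonneg ?_
        rw [mem_closedBall_zero_iff, abs_of_nonneg (by positivity)] at hu
        rw [zero_sub, norm_neg, ← div_eq_mul_inv, one_le_div (norm_pos_iff.2 hu0)]
        exact hu
    · simp [hu]
  have h2 := mul_nonneg (hnonneg 0) (log_nonneg hR)
  linarith

theorem circleAverage_abs_log_norm_le {F : ℂ → ℂ}
    (hF : Differentiable ℂ F) {R L : ℝ} (hR : 1 ≤ R) (hL : 1 ≤ L)
    (hFL : ∀ z ∈ sphere (0 : ℂ) R, ‖F z‖ ≤ L) :
    circleAverage (fun z ↦ |log ‖F z‖|) 0 R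
      ≤ 2 * log L - log ‖meromorphicTrailingCoeffAt F 0‖ := by
  have hint : CircleIntegrable (log ‖F ·‖) 0 R :=
    MeromorphicOn.circleIntegrable_log_norm fun z _ ↦ (hF.analyticAt z).meromorphicAt
  have hc : CircleIntegrable (fun _ ↦ 2 * log L) 0 R := circleIntegrable_const _ _ _
  have h1 : circleAverage (fun z ↦ |log ‖F z‖|) 0 R
      ≤ circleAverage (fun z ↦ 2 * log L - log ‖F z‖) 0 R := by
    refine circleAverage_mono hint.abs (hc.sub hint) fun z hz ↦ ?_
    rw [abs_of_nonneg (by positivity)] at hz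
    have hlog : log ‖F z‖ ≤ log L := by
      rcases eq_or_ne (F z) 0 with h | h
      · simpa [h] using log_nonneg hL
      · exact log_le_log (norm_pos_iff.2 h) (hFL z hz)
    rcases abs_cases (log ‖F z‖) with h | h <;> linarith [log_nonneg hL]
  rw [circleAverage_fun_sub hc hint, circleAverage_const] at h1
  linarith [log_norm_trailingCoeff_le_circleAverage hF hR]

/-- Poisson's formula combined with the Borel–Carathéodory theorem. -/
theorem norm_le_of_circleAverage_abs_re_le {g : ℂ → ℂ}
    (hg : Differentiable ℂ g) {r s R A : ℝ} (hrs : r < s) (hsR : s < R) (hs : 0 < s) (hA : 0 < A)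
    (havg : circleAverage (fun z ↦ |(g z).re|) 0 R ≤ A) {z : ℂ} (hz : ‖z‖ ≤ r) :
    ‖g z‖ ≤ 2 * ((R + s) / (R - s) * A) * r / (s - r) + ‖g 0‖ * (s + r) / (s - r) := by
  have hR : 0 < R := hs.trans hsR
  have hre : ∀ w ∈ ball (0 : ℂ) s, (g w).re ≤ (R + s) / (R - s) * A := by
    intro w hw
    rw [mem_ball_zero_iff] at hw
    have hwR : w ∈ ball (0 : ℂ) R := by rw [mem_ball_zero_iff]; exact hw.trans hsR
    have hharm : InnerProductSpace.HarmonicOnNhd (fun z ↦ (g z).re) (closedBall 0 R) :=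
      fun z _ ↦ (hg.analyticAt z).harmonicAt_re
    rw [← hharm.circleAverage_re_herglotzRieszKernel_smul hwR]
    have hcont : ContinuousOn (fun z ↦ |(g z).re|) (sphere 0 |R|) :=
      (continuous_abs.comp (Complex.continuous_re.comp hg.continuous)).continuousOn
    have hk : ContinuousOn (Complex.re ∘ herglotzRieszKernel 0 w) (sphere 0 |R|) :=
      Complex.continuous_re.comp_continuousOn (continuousOn_herglotzRieszKernel_sphere hwR)
    calc circleAverage ((Complex.re ∘ herglotzRieszKernel 0 w) • fun z ↦ (g z).re) 0 R
        ≤ circleAverage (fun z ↦ ((R + s) / (R - s)) • |(g z).re|) 0 R := by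
          refine circleAverage_mono ?_ ?_ fun x hx ↦ ?_
          · exact (hk.smul
              (Complex.continuous_re.comp hg.continuous).continuousOn).circleIntegrable'
          · exact ContinuousOn.circleIntegrable' (by fun_prop)
          · rw [abs_of_pos hR] at hx
            have h1 := re_herglotzRieszKernel_le hx hwR
            have h2 := le_re_herglotzRieszKernel hx hwR
            rw [sub_zero w] at h1 h2
            have h3 : 0 ≤ (R - ‖w‖) / (R + ‖w‖) :=
              div_nonneg (by linarith) (by positivity)
            have h4 : (R + ‖w‖) / (R - ‖w‖) ≤ (R + s) / (R - s) := by
              have : 0 < R - s := by linarith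
              gcongr
            simp only [Pi.smul_apply', Function.comp_apply, smul_eq_mul, herglotzRieszKernel_def,
              sub_zero w]
            exact (mul_le_mul_of_nonneg_left (le_abs_self _) (h3.trans h2)).trans
              (mul_le_mul_of_nonneg_right (h1.trans h4) (abs_nonneg _))
      _ = (R + s) / (R - s) * circleAverage (fun z ↦ |(g z).re|) 0 R := circleAverage_fun_smul
      _ ≤ _ := by
          have : 0 < R - s := by linarith
          gcongr
  have hM : 0 < (R + s) / (R - s) * A := by
    have : 0 < R - s := by linarith
    positivity
  have hzs : z ∈ ball (0 : ℂ) s := by rw [mem_ball_zero_iff]; linarith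
  refine (Complex.borelCaratheodory hM hg.differentiableOn hre hs hzs).trans ?_
  have : 0 < s - r := by linarith
  have hr : 0 ≤ r := (norm_nonneg z).trans hz
  gcongr

/-- Borel's growth lemma: along arbitrarily large `r`, a monotone function `U ≥ 1` at most doubles
between `r` and `r + r / U r`. -/
theorem exists_apply_add_div_le_two_mul {U : ℝ → ℝ} (hU : Monotone U) (h1 : ∀ r, 1 ≤ U r)
    {r₀ : ℝ} (hr₀ : 0 < r₀) : ∃ r ≥ r₀, U (r + r / U r) ≤ 2 * U r := by
  by_contra! H
  let x : ℕ → ℝ := fun n ↦ (fun r ↦ r + r / U r)^[n] r₀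
  have hx (n) : x (n + 1) = x n + x n / U (x n) := Function.iterate_succ_apply' ..
  have hU0 (r) : 0 < U r := one_pos.trans_le (h1 r)
  have key (n) : r₀ ≤ x n ∧ x n ≤ r₀ * Real.exp (2 - 2 * (1 / 2) ^ n) ∧ 2 ^ n ≤ U (x n) := by
    induction n with
    | zero => simp [x, h1]
    | succ n ih =>
      obtain ⟨ih1, ih2, ih3⟩ := ih
      have hxn : 0 < x n := hr₀.trans_le ih1
      have hxU : 0 < x n / U (x n) := div_pos hxn (hU0 _)
      rw [hx]
      refine ⟨by linarith, ?_, ?_⟩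
      · have h2 : 1 / U (x n) ≤ (1 / 2) ^ n := by
          rw [one_div_pow]; exact one_div_le_one_div_of_le (by positivity) ih3
        calc x n + x n / U (x n) = x n * (1 / U (x n) + 1) := by ring
          _ ≤ (r₀ * Real.exp (2 - 2 * (1 / 2) ^ n)) * Real.exp ((1 / 2) ^ n) := by
            gcongr
            · have := hU0 (x n); positivity
            · linarith [Real.add_one_le_exp ((1 / 2 : ℝ) ^ n)]
          _ = r₀ * Real.exp (2 - 2 * (1 / 2) ^ (n + 1)) := by
            rw [mul_assoc, ← Real.exp_add]; ring_nf
      · have := H (x n) ih1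
        rw [pow_succ]; linarith
  obtain ⟨n, hn⟩ := pow_unbounded_of_one_lt (U (r₀ * Real.exp 2)) one_lt_two
  obtain ⟨-, h2, h3⟩ := key n
  have : x n ≤ r₀ * Real.exp 2 := h2.trans (by gcongr; simp)
  linarith [hU this]

/-- Cauchy's estimate on concentric disks. -/
theorem norm_deriv_le_div_of_norm_le {F : ℂ → ℂ} (hF : Differentiable ℂ F) {ρ η B : ℝ}
    (hη : 0 < η) (hB : ∀ z, ‖z‖ ≤ ρ + η → ‖F z‖ ≤ B) {z : ℂ} (hz : ‖z‖ ≤ ρ) :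
    ‖deriv F z‖ ≤ B / η := by
  refine Complex.norm_deriv_le_of_forall_mem_sphere_norm_le hη hF.diffContOnCl fun w hw ↦ hB w ?_
  rw [mem_sphere_iff_norm] at hw
  linarith [norm_sub_norm_le w z]

theorem circleAverage_abs_log_norm_le_of_mul_eq {f D v : ℂ → ℂ} (hf : ∀ z, f z ≠ 0)
    (hD : Differentiable ℂ D) (hv : Differentiable ℂ v) (hmul : ∀ z, f z * D z = v z)
    {z₀ : ℂ} (hz₀ : D z₀ ≠ 0) {R L : ℝ} (hR : 1 ≤ R) (hL : 1 ≤ L)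
    (hDL : ∀ z ∈ sphere (0 : ℂ) R, ‖D z‖ ≤ L) (hvL : ∀ z ∈ sphere (0 : ℂ) R, ‖v z‖ ≤ L) :
    circleAverage (fun z ↦ |log ‖f z‖|) 0 R ≤ 4 * log L
      - log ‖meromorphicTrailingCoeffAt v 0‖ - log ‖meromorphicTrailingCoeffAt D 0‖ := by
  have hint {F : ℂ → ℂ} (hF : Differentiable ℂ F) : CircleIntegrable (fun z ↦ log ‖F z‖) 0 R :=
    MeromorphicOn.circleIntegrable_log_norm fun z _ ↦ (hF.analyticAt z).meromorphicAt
  have hcongr : circleAverage (fun z ↦ |log ‖f z‖|) 0 R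
      = circleAverage (fun z ↦ |log ‖v z‖ - log ‖D z‖|) 0 R := by
    refine circleAverage_congr_codiscreteWithin ?_ (by positivity)
    have hcod := AnalyticOnNhd.preimage_zero_mem_codiscrete (f := D)
      (fun z _ ↦ hD.analyticAt z) hz₀
    filter_upwards [Filter.codiscreteWithin_mono (Set.subset_univ _) hcod] with z hz
    have hz : D z ≠ 0 := hz
    rw [← hmul z, norm_mul, log_mul (norm_ne_zero_iff.2 (hf z)) (norm_ne_zero_iff.2 hz),
      add_sub_cancel_right]
  rw [hcongr]
  calc circleAverage (fun z ↦ |log ‖v z‖ - log ‖D z‖|) 0 R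
      ≤ circleAverage (fun z ↦ |log ‖v z‖| + |log ‖D z‖|) 0 R :=
        circleAverage_mono ((hint hv).sub (hint hD)).abs ((hint hv).abs.add (hint hD).abs)
          fun z _ ↦ abs_sub _ _
    _ = circleAverage (fun z ↦ |log ‖v z‖|) 0 R + circleAverage (fun z ↦ |log ‖D z‖|) 0 R :=
        circleAverage_fun_add (hint hv).abs (hint hD).abs
    _ ≤ _ := by
      linarith [circleAverage_abs_log_norm_le hv hR hL hvL,
        circleAverage_abs_log_norm_le hD hR hL hDL]

/-- The defect `h' g' - g'' - g' ^ 2`, which for `exp h = (exp g)' - 1` equals `h' / exp g`. -/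
noncomputable def logDerivDefect (g h : ℂ → ℂ) (z : ℂ) : ℂ :=
  deriv h z * deriv g z - deriv (deriv g) z - deriv g z ^ 2

theorem exp_mul_logDerivDefect {g h : ℂ → ℂ} (hg : Differentiable ℂ g) (hh : Differentiable ℂ h)
    (hexp : ∀ z, Complex.exp (h z) = deriv g z * Complex.exp (g z) - 1) (z : ℂ) :
    Complex.exp (g z) * logDerivDefect g h z = deriv h z := by
  have hu : Differentiable ℂ (deriv g) := hg.contDiff.differentiable_deriv_two
  have h1 : HasDerivAt (fun z ↦ Complex.exp (h z)) (Complex.exp (h z) * deriv h z) z :=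
    (hh z).hasDerivAt.cexp
  have h2 : HasDerivAt (fun z ↦ Complex.exp (h z)) (deriv (deriv g) z * Complex.exp (g z)
      + deriv g z * (Complex.exp (g z) * deriv g z)) z := by
    simp_rw [hexp]
    exact ((hu z).hasDerivAt.mul (hg z).hasDerivAt.cexp).sub_const 1
  have h3 := h1.unique h2
  rw [hexp] at h3
  rw [logDerivDefect]
  linear_combination h3

theorem re_le_add_norm_of_exp_eq {a b w : ℂ} (hexp : Complex.exp b = w * Complex.exp a - 1) :
    b.re ≤ ‖a‖ + ‖w‖ := by
  rw [← exp_le_exp, ← Complex.norm_exp, hexp, add_comm, exp_add]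
  have h1 : ‖w * Complex.exp a‖ ≤ ‖w‖ * exp ‖a‖ := by
    rw [norm_mul, Complex.norm_exp]
    gcongr
    exact Complex.re_le_norm a
  have h2 : (‖w‖ + 1) * exp ‖a‖ ≤ exp ‖w‖ * exp ‖a‖ := by
    gcongr
    exact add_one_le_exp _
  have h3 : 1 ≤ exp ‖a‖ := one_le_exp (norm_nonneg a)
  calc ‖w * Complex.exp a - 1‖ ≤ ‖w * Complex.exp a‖ + ‖(1 : ℂ)‖ := norm_sub_le _ _
    _ ≤ _ := by rw [norm_one]; linarith

/-- Polynomial bounds for `h'` and the defect in terms of a bound for `g` on a larger disk. -/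
theorem exists_norm_deriv_le_and_norm_logDerivDefect_le {g h : ℂ → ℂ} (hg : Differentiable ℂ g)
    (hh : Differentiable ℂ h)
    (hexp : ∀ z, Complex.exp (h z) = deriv g z * Complex.exp (g z) - 1) :
    ∃ K ≥ 1, ∀ r η m : ℝ, 1 ≤ r → 0 < η → η ≤ r → 1 ≤ m → (∀ z, ‖z‖ ≤ r + 6 * η → ‖g z‖ ≤ m) →
      ∀ z, ‖z‖ ≤ r + 3 * η → ‖deriv h z‖ ≤ K * m ^ 2 * (r / η) ^ 4 ∧
        ‖logDerivDefect g h z‖ ≤ K * m ^ 2 * (r / η) ^ 4 := by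
  have hu : Differentiable ℂ (deriv g) := hg.contDiff.differentiable_deriv_two
  refine ⟨26 + 12 * ‖h 0‖, by linarith [norm_nonneg (h 0)], ?_⟩
  intro r η m hr hη hηr hm hgm z hz
  obtain ⟨q, hq⟩ : ∃ q, q = r / η := ⟨_, rfl⟩
  have hq1 : 1 ≤ q := by rw [hq, one_le_div hη]; exact hηr
  have hrq : r = q * η := by rw [hq]; field_simp
  have hdiv (B : ℝ) (hB : 0 ≤ B) : B / η ≤ B * q := by
    rw [div_le_iff₀ hη, mul_assoc, ← hrq]; exact le_mul_of_one_le_right hB hr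
  have hu5 : ∀ z, ‖z‖ ≤ r + 5 * η → ‖deriv g z‖ ≤ m * q := fun z hz ↦
    (norm_deriv_le_div_of_norm_le hg hη (fun w hw ↦ hgm w (by linarith)) hz).trans
      (hdiv m (by positivity))
  have hu' : ‖deriv (deriv g) z‖ ≤ m * q * q :=
    (norm_deriv_le_div_of_norm_le hu hη (fun w hw ↦ hu5 w (by linarith)) hz).trans
      (hdiv _ (by positivity))
  have hh4 : ∀ z, ‖z‖ ≤ r + 4 * η → ‖h z‖ ≤ (24 + 12 * ‖h 0‖) * m * q ^ 2 := by
    intro z hz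
    have hmaps : Set.MapsTo h (ball 0 (r + 5 * η)) {z | z.re ≤ 2 * m * q} := by
      intro w hw
      rw [mem_ball_zero_iff] at hw
      have := re_le_add_norm_of_exp_eq (hexp w)
      have := hgm w (by linarith)
      have := hu5 w hw.le
      have : m ≤ m * q := le_mul_of_one_le_right (by positivity) hq1
      simp only [Set.mem_ofPred_eq]
      linarith
    have hbc := Complex.borelCaratheodory (M := 2 * m * q) (z := z) (by positivity)
      hh.differentiableOn hmaps
      (by positivity) (by rw [mem_ball_zero_iff]; linarith)
    have hmono : 2 * (2 * m * q) * ‖z‖ / (r + 5 * η - ‖z‖)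
        + ‖h 0‖ * (r + 5 * η + ‖z‖) / (r + 5 * η - ‖z‖)
        ≤ 2 * (2 * m * q) * (6 * r) / η + ‖h 0‖ * (12 * r) / η := by
      gcongr <;> linarith
    refine hbc.trans (hmono.trans ?_)
    have e : 2 * (2 * m * q) * (6 * r) / η + ‖h 0‖ * (12 * r) / η
        = 24 * m * q ^ 2 + 12 * ‖h 0‖ * q := by
      rw [hrq]; field_simp; ring
    rw [e]
    have h5 : q ≤ m * q ^ 2 := by nlinarith [mul_le_mul hm hq1 zero_le_one (by positivity)]
    nlinarith [mul_le_mul_of_nonneg_left h5 (norm_nonneg (h 0))]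
  have hv : ‖deriv h z‖ ≤ (24 + 12 * ‖h 0‖) * m * q ^ 2 * q :=
    (norm_deriv_le_div_of_norm_le hh hη (fun w hw ↦ hh4 w (by linarith)) hz).trans
      (hdiv _ (by positivity))
  have hu3 := hu5 z (by linarith)
  have hm2 : m ≤ m ^ 2 := le_self_pow₀ hm two_ne_zero
  have hq34 : q ^ 3 ≤ q ^ 4 := pow_le_pow_right₀ hq1 (by norm_num)
  have hq24 : q ^ 2 ≤ q ^ 4 := pow_le_pow_right₀ hq1 (by norm_num)
  rw [← hq]
  constructor
  · calc ‖deriv h z‖ ≤ (24 + 12 * ‖h 0‖) * m * q ^ 2 * q := hv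
      _ = (24 + 12 * ‖h 0‖) * m * q ^ 3 := by ring
      _ ≤ (26 + 12 * ‖h 0‖) * m ^ 2 * q ^ 4 := by gcongr; norm_num
  · calc ‖logDerivDefect g h z‖
        ≤ ‖deriv h z‖ * ‖deriv g z‖ + ‖deriv (deriv g) z‖ + ‖deriv g z‖ ^ 2 := by
          rw [← norm_mul, ← norm_pow]
          refine (norm_sub_le _ _).trans ?_
          gcongr
          exact norm_sub_le _ _
      _ ≤ (24 + 12 * ‖h 0‖) * m * q ^ 2 * q * (m * q) + m * q * q + (m * q) ^ 2 := by gcongr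
      _ = (24 + 12 * ‖h 0‖) * m ^ 2 * q ^ 4 + m * q ^ 2 + m ^ 2 * q ^ 2 := by ring
      _ ≤ (24 + 12 * ‖h 0‖) * m ^ 2 * q ^ 4 + m ^ 2 * q ^ 4 + m ^ 2 * q ^ 4 := by gcongr
      _ = _ := by ring

/-- A form of the second main theorem: if the defect does not vanish identically, then `g` is
bounded by the logarithm of its maximum on a slightly larger disk. -/
theorem exists_norm_le_mul_log_of_logDerivDefect_ne_zero {g h : ℂ → ℂ} (hg : Differentiable ℂ g)
    (hh : Differentiable ℂ h)
    (hexp : ∀ z, Complex.exp (h z) = deriv g z * Complex.exp (g z) - 1) {z₀ : ℂ}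
    (hz₀ : logDerivDefect g h z₀ ≠ 0) :
    ∃ C > 0, ∀ r η m : ℝ, 1 ≤ r → 0 < η → η ≤ r → 1 ≤ m → (∀ z, ‖z‖ ≤ r + 6 * η → ‖g z‖ ≤ m) →
      ∀ z, ‖z‖ ≤ r → ‖g z‖ ≤ C * (r / η) ^ 2 * (1 + log m + log (r / η)) := by
  have hu : Differentiable ℂ (deriv g) := hg.contDiff.differentiable_deriv_two
  have hu' : Differentiable ℂ (deriv (deriv g)) := hu.contDiff.differentiable_deriv_two
  have hv : Differentiable ℂ (deriv h) := hh.contDiff.differentiable_deriv_two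
  have hD : Differentiable ℂ (logDerivDefect g h) := ((hv.mul hu).sub hu').sub (hu.pow 2)
  obtain ⟨K, hK, hKb⟩ := exists_norm_deriv_le_and_norm_logDerivDefect_le hg hh hexp
  set κ₁ := log ‖meromorphicTrailingCoeffAt (deriv h) 0‖
  set κ₂ := log ‖meromorphicTrailingCoeffAt (logDerivDefect g h) 0‖
  obtain ⟨C₁, hC₁⟩ : ∃ C₁, C₁ = 16 + 4 * log K + |κ₁| + |κ₂| := ⟨_, rfl⟩
  have hlK := log_nonneg hK
  have hC₁0 : 16 + 4 * log K ≤ C₁ := by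
    rw [hC₁]; linarith [abs_nonneg κ₁, abs_nonneg κ₂]
  refine ⟨7 * C₁ + 2 * ‖g 0‖, by linarith [norm_nonneg (g 0)], ?_⟩
  intro r η m hr hη hηr hm hgm z hz
  have hb := hKb r η m hr hη hηr hm hgm
  obtain ⟨q, hq⟩ : ∃ q, q = r / η := ⟨_, rfl⟩
  have hq1 : 1 ≤ q := by rw [hq, one_le_div hη]; exact hηr
  have hrq : r = q * η := by rw [hq]; field_simp
  rw [← hq] at hb ⊢
  have hlm := log_nonneg hm
  have hlq := log_nonneg hq1
  obtain ⟨T, hT⟩ : ∃ T, T = 1 + log m + log q := ⟨_, rfl⟩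
  have hT1 : 1 ≤ T := by linarith
  rw [← hT]
  have hL : 1 ≤ K * m ^ 2 * q ^ 4 :=
    one_le_mul_of_one_le_of_one_le (one_le_mul_of_one_le_of_one_le hK (one_le_pow₀ hm))
      (one_le_pow₀ hq1)
  have hlogL : log (K * m ^ 2 * q ^ 4) = log K + 2 * log m + 4 * log q := by
    rw [log_mul (by positivity) (by positivity), log_mul (by positivity) (by positivity),
      log_pow, log_pow]
    norm_num
  have hA := circleAverage_abs_log_norm_le_of_mul_eq (fun z ↦ Complex.exp_ne_zero (g z)) hD hv
    (exp_mul_logDerivDefect hg hh hexp) hz₀ (R := r + 3 * η) (by linarith) hL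
    (fun w hw ↦ (hb w (by rw [mem_sphere_zero_iff_norm] at hw; exact hw.le)).2)
    (fun w hw ↦ (hb w (by rw [mem_sphere_zero_iff_norm] at hw; exact hw.le)).1)
  simp only [Complex.norm_exp, log_exp, hlogL] at hA
  replace hA : circleAverage (fun z ↦ |(g z).re|) 0 (r + 3 * η) ≤ C₁ * T := by
    refine hA.trans ?_
    have h1 : C₁ ≤ C₁ * T := le_mul_of_one_le_right (by linarith) hT1
    have h2 : C₁ * T = C₁ + C₁ * log m + C₁ * log q := by rw [hT]; ring
    have h3 : 8 * log m ≤ C₁ * log m := by gcongr; linarith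
    have h4 : 16 * log q ≤ C₁ * log q := by gcongr; linarith
    rw [h2, hC₁] at *
    linarith [neg_abs_le κ₁, neg_abs_le κ₂]
  have hC₁T : 0 < C₁ * T := mul_pos (by linarith) (by linarith)
  refine (norm_le_of_circleAverage_abs_re_le hg (s := r + 2 * η) (by linarith) (by linarith)
    (by linarith) hC₁T hA hz).trans ?_
  have e : 2 * ((r + 3 * η + (r + 2 * η)) / (r + 3 * η - (r + 2 * η)) * (C₁ * T)) * r
      / (r + 2 * η - r) + ‖g 0‖ * (r + 2 * η + r) / (r + 2 * η - r)
      = (2 * q + 5) * q * (C₁ * T) + ‖g 0‖ * (q + 1) := by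
    rw [hrq]; ring_nf; field_simp; ring
  rw [e]
  have h1 : (2 * q + 5) * q * (C₁ * T) ≤ 7 * q ^ 2 * (C₁ * T) := by
    have : (2 * q + 5) * q ≤ 7 * q ^ 2 := by nlinarith
    gcongr
  have h2 : q + 1 ≤ 2 * (q ^ 2 * T) := by
    have : q ≤ q ^ 2 := le_self_pow₀ hq1 two_ne_zero
    have : q ^ 2 ≤ q ^ 2 * T := le_mul_of_one_le_right (by positivity) hT1
    linarith
  have h3 := mul_le_mul_of_nonneg_left h2 (norm_nonneg (g 0))
  nlinarith

/-- A continuous function satisfying a Nevanlinna-type self-improving growth estimate is bounded. -/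
theorem exists_norm_le_of_norm_le_mul_log {g : ℂ → ℂ} (hg : Continuous g) {C : ℝ} (hC : 0 < C)
    (hest : ∀ r η m : ℝ, 1 ≤ r → 0 < η → η ≤ r → 1 ≤ m → (∀ z, ‖z‖ ≤ r + 6 * η → ‖g z‖ ≤ m) →
      ∀ z, ‖z‖ ≤ r → ‖g z‖ ≤ C * (r / η) ^ 2 * (1 + log m + log (r / η))) :
    ∃ B, ∀ z, ‖g z‖ ≤ B := by
  let M : ℝ → ℝ := fun r ↦ 1 + sSup ((fun z ↦ ‖g z‖) '' closedBall 0 (max r 0))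
  have hbdd (r) : BddAbove ((fun z ↦ ‖g z‖) '' closedBall 0 (max r 0)) :=
    ((isCompact_closedBall _ _).image hg.norm).bddAbove
  have hM1 (r) : 1 ≤ M r := by
    have : 0 ≤ sSup ((fun z ↦ ‖g z‖) '' closedBall 0 (max r 0)) :=
      sSup_nonneg (by rintro _ ⟨z, -, rfl⟩; exact norm_nonneg _)
    simp only [M]; linarith
  have hMmono : Monotone M := fun a b hab ↦ by
    simp only [M]
    gcongr
    · exact hbdd b
    · exact ⟨_, 0, by simp, rfl⟩
  have hle {r : ℝ} {z : ℂ} (hz : ‖z‖ ≤ r) : ‖g z‖ + 1 ≤ M r := by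
    have : ‖g z‖ ≤ sSup ((fun z ↦ ‖g z‖) '' closedBall 0 (max r 0)) :=
      le_csSup (hbdd r) ⟨z, by simp [hz], rfl⟩
    simp only [M]; linarith
  have hMle {r B : ℝ} (hr : 0 ≤ r) (hB : ∀ z, ‖z‖ ≤ r → ‖g z‖ ≤ B) : M r ≤ 1 + B := by
    simp only [M, max_eq_left hr]
    gcongr
    refine csSup_le ⟨_, 0, by simp [hr], rfl⟩ ?_
    rintro _ ⟨z, hz, rfl⟩
    exact hB z (by simpa using hz)
  let U : ℝ → ℝ := fun r ↦ 1 + log (M r)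
  have hU1 (r) : 1 ≤ U r := by simp only [U]; linarith [log_nonneg (hM1 r)]
  have hUmono : Monotone U := fun a b hab ↦ by
    simp only [U]
    have := log_le_log (one_pos.trans_le (hM1 a)) (hMmono hab)
    linarith
  have hsmall : ∃ B, ∀ x, 1 ≤ x → x ≤ 1 + C * 324 * (1 + log x) ^ 3 → x ≤ B := by
    have ho : (fun x ↦ log x ^ 3) =o[Filter.atTop] id := isLittleO_pow_log_id_atTop
    have hev := ho.bound (show 0 < 1 / (C * 324 * 32) by positivity)
    rw [Filter.eventually_atTop] at hev
    obtain ⟨X, hX⟩ := hev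
    refine ⟨max X (exp 3), fun x hx1 hx ↦ ?_⟩
    by_contra! hlt
    have hxe : exp 3 < x := (le_max_right _ _).trans_lt hlt
    have hlog : 3 < log x := (lt_log_iff_exp_lt (by positivity)).2 hxe
    have hx3 : 3 < x := by linarith [add_one_le_exp (3 : ℝ)]
    have hX' := hX x ((le_max_left _ _).trans hlt.le)
    rw [norm_of_nonneg (by positivity), id, norm_of_nonneg (by positivity),
      one_div_mul_eq_div, le_div_iff₀ (by positivity)] at hX'
    have : C * 324 * (1 + log x) ^ 3 ≤ C * 324 * (2 * log x) ^ 3 := by gcongr; linarith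
    linarith
  obtain ⟨B, hB⟩ := hsmall
  refine ⟨B, fun z ↦ ?_⟩
  obtain ⟨r, hr, hrU⟩ := exists_apply_add_div_le_two_mul hUmono hU1
    (r₀ := max 1 ‖z‖) (by positivity)
  have hr1 : 1 ≤ r := (le_max_left _ _).trans hr
  have hU0 : 0 < U r := one_pos.trans_le (hU1 r)
  suffices M r ≤ B by linarith [hle ((le_max_right _ _).trans hr)]
  refine hB _ (hM1 r) ?_
  have e : r + 6 * (r / (6 * U r)) = r + r / U r := by field_simp
  have e' : r / (r / (6 * U r)) = 6 * U r := by field_simp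
  have hb := hest r (r / (6 * U r)) (M (r + r / U r)) hr1 (by positivity)
    (div_le_self (by linarith) (by linarith [hU1 r])) (hM1 _)
    (fun w hw ↦ by rw [e] at hw; linarith [hle hw])
  rw [e'] at hb
  refine hMle (by linarith) fun w hw ↦ (hb w hw).trans ?_
  have hlog6 : log (6 * U r) ≤ 6 * U r := log_le_self (by positivity)
  have hrU' : 1 + log (M (r + r / U r)) ≤ 2 * U r := hrU
  calc C * (6 * U r) ^ 2 * (1 + log (M (r + r / U r)) + log (6 * U r))
      ≤ C * (6 * U r) ^ 2 * (9 * U r) := by gcongr; linarith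
    _ = C * 324 * (1 + log (M r)) ^ 3 := by simp only [U]; ring

end

/-- **Polya–Saxer–Millioux theorem.** An entire function `f` omitting `0`
whose derivative omits `1` must be constant. -/
theorem polya_saxer_millioux (f : ℂ → ℂ) (hf : Differentiable ℂ f)
    (h0 : ∀ z : ℂ, f z ≠ 0) (h1 : ∀ z : ℂ, deriv f z ≠ 1) :
    ∃ A : ℂ, ∀ z : ℂ, f z = A := by
  have hf' : Differentiable ℂ (deriv f) := hf.contDiff.differentiable_deriv_two
  obtain ⟨g, hg, hgf⟩ := exists_exp_eq_of_differentiable hf h0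
  obtain ⟨h, hh, hhf⟩ := exists_exp_eq_of_differentiable (hf'.sub_const 1)
    fun z ↦ sub_ne_zero.2 (h1 z)
  have hfg (z) : deriv f z = deriv g z * Complex.exp (g z) := by
    rw [← funext hgf, mul_comm]
    exact (hg z).hasDerivAt.cexp.deriv
  have hexp (z) : Complex.exp (h z) = deriv g z * Complex.exp (g z) - 1 := by
    rw [hhf, hfg]
  by_cases hD : ∀ z, logDerivDefect g h z = 0
  · have hh' (z) : deriv h z = 0 := by rw [← exp_mul_logDerivDefect hg hh hexp, hD, mul_zero]
    have hconst (z) : deriv f z = deriv f 0 := by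
      have := hhf z
      rw [is_const_of_deriv_eq_zero hh hh' z 0, hhf 0] at this
      exact (sub_left_injective this).symm
    have haff (z) : f z = f 0 + deriv f 0 * z := by
      have hder (w) : HasDerivAt (fun w ↦ f w - deriv f 0 * w) 0 w := by
        convert! (hf w).hasDerivAt.sub ((hasDerivAt_id w).const_mul (deriv f 0)) using 1
        rw [hconst w, mul_one, sub_self]
      have := is_const_of_deriv_eq_zero (fun w ↦ (hder w).differentiableAt)
        (fun w ↦ (hder w).deriv) z 0
      simp only [mul_zero, sub_zero] at this
      linear_combination this
    have hslope : deriv f 0 = 0 := by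
      by_contra hne
      refine h0 (-f 0 / deriv f 0) ?_
      rw [haff]
      field_simp
      ring
    exact ⟨f 0, fun z ↦ by rw [haff, hslope, zero_mul, add_zero]⟩
  · push Not at hD
    obtain ⟨z₀, hz₀⟩ := hD
    obtain ⟨C, hC, hest⟩ := exists_norm_le_mul_log_of_logDerivDefect_ne_zero hg hh hexp hz₀
    obtain ⟨B, hB⟩ := exists_norm_le_of_norm_le_mul_log hg.continuous hC hest
    refine ⟨f 0, fun z ↦ ?_⟩
    rw [← hgf, ← hgf, hg.apply_eq_apply_of_bounded ?_ z 0]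
    exact (isBounded_iff_forall_norm_le).2 ⟨B, by rintro _ ⟨w, rfl⟩; exact hB w⟩
end

section
/- Let a : ℂ → ℂ be an entire function, let c, d ∈ ℂ with d ≠ 0, and let P : ℂ × ℂ → ℂ be an entire function that is divisible by (z₁ − c)(z₂ − d) in the ring of entire functions, i.e., there is an entire function g : ℂ × ℂ → ℂ with P(z₁, z₂) = (z₁ − c)(z₂ − d)·g(z₁, z₂) for all z₁, z₂ ∈ ℂ. Then every entire function f : ℂ → ℂ satisfying the differential equation f'(z) + a(z)·P(f(z), f'(z)) = 0 for all z ∈ ℂ is constant. -/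
open Complex Metric Real Filter Topology

theorem exists_eq_mul_exp_of_deriv_eq_mul {F q : ℂ → ℂ} (hF : Differentiable ℂ F)
    (hq : Differentiable ℂ q) (h : ∀ z, deriv F z = q z * F z) :
    ∃ Q : ℂ → ℂ, Differentiable ℂ Q ∧ ∀ z, F z = F 0 * Complex.exp (Q z) := by
  obtain ⟨Q, hQ0, hQ⟩ := hq.isExactOn_univ.with_val_at 0 0
  replace hQ : ∀ z, HasDerivAt Q (q z) z := fun z => hQ z (Set.mem_univ z)
  refine ⟨Q, fun z => (hQ z).differentiableAt, fun z => ?_⟩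
  have hder : ∀ z, HasDerivAt (fun z => F z * Complex.exp (-Q z)) 0 z := by
    intro z
    refine ((hF z).hasDerivAt.mul (hQ z).neg.cexp).congr_deriv ?_
    rw [h z, Pi.neg_apply]
    ring
  have hc := is_const_of_deriv_eq_zero (fun z => (hder z).differentiableAt)
    (fun z => (hder z).deriv) z 0
  simp only [hQ0, neg_zero, Complex.exp_zero, mul_one] at hc
  rw [← hc, mul_assoc, ← Complex.exp_add, neg_add_cancel, Complex.exp_zero, mul_one]

theorem exists_eq_exp_of_forall_ne_zero {F : ℂ → ℂ} (hF : Differentiable ℂ F)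
    (h0 : ∀ z, F z ≠ 0) :
    ∃ h : ℂ → ℂ, Differentiable ℂ h ∧ ∀ z, F z = Complex.exp (h z) := by
  obtain ⟨Q, hQ, hFQ⟩ := exists_eq_mul_exp_of_deriv_eq_mul hF (q := fun z => deriv F z / F z)
    (hF.deriv.div hF h0) (fun z => (div_mul_cancel₀ _ (h0 z)).symm)
  refine ⟨fun z => Complex.log (F 0) + Q z, hQ.const_add _, fun z => ?_⟩
  rw [Complex.exp_add, Complex.exp_log (h0 0), hFQ z]

theorem re_le_mul_circleAverage_abs_re {h : ℂ → ℂ} (hh : Differentiable ℂ h) {ρ R : ℝ} {w : ℂ}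
    (hw : ‖w‖ ≤ ρ) (hρ : ρ < R) :
    (h w).re ≤ (R + ρ) / (R - ρ) * circleAverage (fun z => |(h z).re|) 0 R := by
  have hR : 0 < R := (norm_nonneg w).trans_lt (hw.trans_lt hρ)
  have hwb : w ∈ ball (0 : ℂ) R := by simpa using hw.trans_lt hρ
  have hP := InnerProductSpace.HarmonicOnNhd.circleAverage_re_herglotzRieszKernel_smul
    (f := fun z => (h z).re) (c := 0) (R := R) (w := w)
    (fun x _ => (hh.analyticAt x).harmonicAt_re) hwb
  rw [← hP, ← smul_eq_mul, ← Real.circleAverage_fun_smul]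
  have hcont : Continuous (fun z => (h z).re) := Complex.continuous_re.comp hh.continuous
  refine Real.circleAverage_mono ?_ ?_ ?_
  · refine ContinuousOn.circleIntegrable' ?_
    refine ContinuousOn.smul ?_ hcont.continuousOn
    exact Complex.continuous_re.comp_continuousOn (continuousOn_herglotzRieszKernel_sphere hwb)
  · have : Continuous fun z => ((R + ρ) / (R - ρ)) • |(h z).re| := by fun_prop
    exact this.continuousOn.circleIntegrable hR.le
  · intro x hx
    rw [abs_of_pos hR] at hx
    have h1 := re_herglotzRieszKernel_le hx hwb
    have h2 := le_re_herglotzRieszKernel hx hwb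
    simp only [sub_zero] at h1 h2
    have hwR := hw.trans_lt hρ
    have h0 : 0 ≤ ((x + w) / (x - w)).re :=
      le_trans (by have := norm_nonneg w; apply div_nonneg <;> linarith) h2
    have h3 : (R + ‖w‖) / (R - ‖w‖) ≤ (R + ρ) / (R - ρ) := by
      apply div_le_div₀ <;> linarith [norm_nonneg w]
    have e : ((re ∘ herglotzRieszKernel 0 w) • fun z => (h z).re) x =
        ((x + w) / (x - w)).re * (h x).re := by
      simp [herglotzRieszKernel_def]
    rw [e, smul_eq_mul]
    exact (mul_le_mul_of_nonneg_left (le_abs_self _) h0).trans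
      (mul_le_mul_of_nonneg_right (h1.trans h3) (abs_nonneg _))

theorem log_norm_le_circleAverage {g : ℂ → ℂ} (hg : Differentiable ℂ g) (h0 : g 0 ≠ 0) {R : ℝ}
    (hR : 0 < R) : Real.log ‖g 0‖ ≤ circleAverage (fun z => Real.log ‖g z‖) 0 R := by
  have ha : AnalyticOnNhd ℂ g (closedBall 0 |R|) := fun z _ => hg.analyticAt z
  rw [ha.circleAverage_log_norm hR.ne' h0]
  refine le_add_of_nonneg_left (finsum_nonneg fun u => ?_)
  by_cases hu : u ∈ closedBall (0 : ℂ) |R|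
  · refine mul_nonneg (mod_cast MeromorphicOn.AnalyticOnNhd.divisor_nonneg ha u) ?_
    rcases eq_or_ne u 0 with rfl | hu0
    · simp
    apply Real.log_nonneg
    rw [zero_sub, norm_neg, ← div_eq_mul_inv, one_le_div (norm_pos_iff.2 hu0)]
    simpa [abs_of_pos hR] using hu
  · simp [hu]

theorem exists_le_mul_one_add_log {S : ℝ → ℝ} (hS : Continuous S) (h1 : ∀ r, 1 ≤ S r) {C : ℝ}
    (hC : 1 ≤ C)
    (h : ∀ r R, 1 ≤ r → r < R → S r ≤ C * (1 + Real.log (R / (R - r) * S R))) :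
    ∃ K : ℝ, ∀ r, 1 ≤ r → S r ≤ K * (1 + Real.log r) := by
  set D : ℝ := 2 * C * (2 + 3 * Real.log (6 * C)) + 1 with hD
  have hlog6 : 0 ≤ Real.log (6 * C) := Real.log_nonneg (by linarith)
  refine ⟨D, fun r₀ hr₀ => ?_⟩
  have hlr : 0 ≤ Real.log r₀ := Real.log_nonneg hr₀
  set A : ℝ := 2 * C * (2 + Real.log r₀ + 3 * Real.log (6 * C)) + 1 with hA
  have hA1 : 1 ≤ A := by
    have : 0 ≤ 2 * C * (2 + Real.log r₀ + 3 * Real.log (6 * C)) := by positivity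
    linarith
  suffices hle : S r₀ ≤ A by
    refine hle.trans ?_
    have : 0 ≤ (2 * C * (1 + 3 * Real.log (6 * C)) + 1) * Real.log r₀ := by positivity
    rw [hA, hD]
    nlinarith
  by_contra! hlt
  set r : ℕ → ℝ := fun n => r₀ + 1 - 1 / (n + 1) with hr
  have hrn : ∀ n, r₀ ≤ r n ∧ r n ≤ r₀ + 1 := by
    intro n
    have h1 : 0 ≤ 1 / ((n : ℝ) + 1) := by positivity
    have h2 : 1 / ((n : ℝ) + 1) ≤ 1 := by
      rw [div_le_one (by positivity)]; linarith [n.cast_nonneg (α := ℝ)]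
    simp only [hr]
    constructor <;> linarith
  have hgrow : ∀ n : ℕ, A + n ≤ S (r n) := by
    intro n
    induction n with
    | zero => simpa [hr] using hlt.le
    | succ n ih =>
      have hn0 : (0 : ℝ) ≤ n := n.cast_nonneg
      have hdiff : r (n + 1) - r n = 1 / (((n : ℝ) + 1) * (n + 2)) := by
        simp only [hr]; push_cast; field_simp; ring
      have hpos : 0 < r (n + 1) - r n := by rw [hdiff]; positivity
      have key := h (r n) (r (n + 1)) (hr₀.trans (hrn n).1) (by linarith)
      have hSp : 0 < S (r (n + 1)) := by linarith [h1 (r (n + 1))]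
      have hRp : 0 < r (n + 1) := by linarith [(hrn (n + 1)).1]
      by_contra! hneg
      push_cast at hneg
      set y : ℝ := A + n + 1 with hy
      have hy0 : 0 < y := by linarith
      have hX : r (n + 1) / (r (n + 1) - r n) * S (r (n + 1)) ≤ 2 * r₀ * (y * y) * y := by
        rw [hdiff, div_div_eq_mul_div, div_one]
        have : r (n + 1) ≤ 2 * r₀ := by linarith [(hrn (n + 1)).2]
        gcongr <;> linarith
      have hlog : Real.log (r (n + 1) / (r (n + 1) - r n) * S (r (n + 1))) ≤
          Real.log 2 + Real.log r₀ + 3 * Real.log y := by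
        refine (Real.log_le_log (by positivity) hX).trans ?_
        rw [Real.log_mul (by positivity) (by positivity), Real.log_mul (by positivity) (by positivity),
          Real.log_mul (by positivity) (by positivity), Real.log_mul (by positivity) (by positivity)]
        linarith
      have hlogy : Real.log y ≤ y / (6 * C) - 1 + Real.log (6 * C) := by
        have : Real.log y = Real.log (y / (6 * C)) + Real.log (6 * C) := by
          rw [← Real.log_mul (by positivity) (by positivity)]
          congr 1; field_simp
        rw [this]
        linarith [Real.log_le_sub_one_of_pos (show 0 < y / (6 * C) by positivity)]
      have hl2 : Real.log 2 ≤ 1 := by linarith [Real.log_two_lt_d9]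
      have : C * (1 + Real.log (r (n + 1) / (r (n + 1) - r n) * S (r (n + 1)))) ≤
          C * (1 + (1 + Real.log r₀ + 3 * (y / (6 * C) - 1 + Real.log (6 * C)))) := by
        gcongr; linarith
      have e : C * (1 + (1 + Real.log r₀ + 3 * (y / (6 * C) - 1 + Real.log (6 * C)))) =
          C * (2 + Real.log r₀ + 3 * Real.log (6 * C)) - 3 * C + y / 2 := by
        field_simp; ring
      rw [e] at this
      linarith
  obtain ⟨B, hB⟩ := (isCompact_Icc (a := r₀) (b := r₀ + 1)).bddAbove_image hS.continuousOn
  obtain ⟨n, hn⟩ := exists_nat_gt B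
  have := hB (Set.mem_image_of_mem S (Set.mem_Icc.2 (hrn n)))
  linarith [hgrow n]

/-- `u` is bounded on each disc `‖z‖ ≤ r` by a fixed polynomial in `R / (R - r) * (T R + 1)`,
for every `R > r ≥ 1`. -/
def PolyBounded (T : ℝ → ℝ) (u : ℂ → ℝ) : Prop :=
  ∃ C : ℝ, 1 ≤ C ∧ ∃ N : ℕ, ∀ r R : ℝ, 1 ≤ r → r < R → ∀ z : ℂ, ‖z‖ ≤ r →
    u z ≤ C * (R / (R - r) * (T R + 1)) ^ N

namespace PolyBounded

variable {T : ℝ → ℝ} {u v : ℂ → ℝ}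

theorem one_le_base {r R t : ℝ} (ht : 0 ≤ t) (hr : 1 ≤ r) (hR : r < R) :
    1 ≤ R / (R - r) * (t + 1) := by
  have : 1 ≤ R / (R - r) := by rw [one_le_div (by linarith)]; linarith
  nlinarith

theorem mono (hv : PolyBounded T v) (h : ∀ z, u z ≤ v z) : PolyBounded T u := by
  obtain ⟨C, hC, N, hN⟩ := hv
  exact ⟨C, hC, N, fun r R hr hR z hz => (h z).trans (hN r R hr hR z hz)⟩

theorem const (T : ℝ → ℝ) (a : ℝ) : PolyBounded T fun _ => a :=
  ⟨max a 1, le_max_right _ _, 0, fun r R _ _ z _ => by simp⟩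

theorem add (hT : ∀ R, 0 ≤ T R) (hu : PolyBounded T u) (hv : PolyBounded T v) :
    PolyBounded T fun z => u z + v z := by
  obtain ⟨C, hC, N, hN⟩ := hu
  obtain ⟨D, hD, M, hM⟩ := hv
  refine ⟨C + D, by linarith, N + M, fun r R hr hR z hz => ?_⟩
  have h1 := one_le_base (hT R) hr hR
  rw [add_mul]
  refine add_le_add ((hN r R hr hR z hz).trans ?_) ((hM r R hr hR z hz).trans ?_)
  · gcongr
    omega
  · gcongr
    omega

theorem mul (hT : ∀ R, 0 ≤ T R) (hv0 : ∀ z, 0 ≤ v z)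
    (hu : PolyBounded T u) (hv : PolyBounded T v) : PolyBounded T fun z => u z * v z := by
  obtain ⟨C, hC, N, hN⟩ := hu
  obtain ⟨D, hD, M, hM⟩ := hv
  refine ⟨C * D, by nlinarith, N + M, fun r R hr hR z hz => ?_⟩
  have h1 := one_le_base (hT R) hr hR
  rw [pow_add, mul_mul_mul_comm]
  exact mul_le_mul (hN r R hr hR z hz) (hM r R hr hR z hz) (hv0 z) (by positivity)

theorem base_midpoint {r R t : ℝ} (hR : r < R) :
    R / (R - (r + R) / 2) * (t + 1) = 2 * (R / (R - r) * (t + 1)) := by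
  have : R - r ≠ 0 := by linarith
  rw [show R - (r + R) / 2 = (R - r) / 2 by ring]
  field_simp

theorem norm_deriv (hT : ∀ R, 0 ≤ T R) {F : ℂ → ℂ} (hF : Differentiable ℂ F)
    (h : PolyBounded T fun z => ‖F z‖) : PolyBounded T fun z => ‖deriv F z‖ := by
  obtain ⟨C, hC, N, hN⟩ := h
  refine ⟨2 * C * 2 ^ N, ?_, N + 1, fun r R hr hR z hz => ?_⟩
  · have : (1 : ℝ) ≤ 2 ^ N := one_le_pow₀ (by norm_num)
    nlinarith
  set X := R / (R - r) * (T R + 1)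
  have hX1 : 1 ≤ X := one_le_base (hT R) hr hR
  have hd : 0 < (R - r) / 2 := by linarith
  have hb : ∀ w ∈ sphere z ((R - r) / 2), ‖F w‖ ≤ C * (2 * X) ^ N := by
    intro w hw
    rw [← base_midpoint hR]
    refine hN _ R (by linarith) (by linarith) w ?_
    have := norm_le_norm_add_norm_sub' w z
    rw [← dist_eq_norm, mem_sphere.1 hw] at this
    linarith
  refine (Complex.norm_deriv_le_of_forall_mem_sphere_norm_le hd hF.diffContOnCl hb).trans ?_
  have h2 : C * (2 * X) ^ N / ((R - r) / 2) = 2 * C * 2 ^ N * X ^ N * (1 / (R - r)) := by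
    rw [mul_pow]; field_simp
  rw [h2, pow_succ, ← mul_assoc]
  gcongr
  have : 1 / (R - r) ≤ R / (R - r) := by gcongr; linarith
  have h3 : 0 ≤ R / (R - r) := by apply div_nonneg <;> linarith
  nlinarith [hT R]

theorem norm_of_re (hT : ∀ R, 0 ≤ T R) {F : ℂ → ℂ} (hF : Differentiable ℂ F)
    (h : PolyBounded T fun z => (F z).re) : PolyBounded T fun z => ‖F z‖ := by
  obtain ⟨C, hC, N, hN⟩ := h
  refine ⟨4 * C * 2 ^ N + 4 * ‖F 0‖, ?_, N + 1, fun r R hr hR z hz => ?_⟩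
  · have : (1 : ℝ) ≤ 2 ^ N := one_le_pow₀ (by norm_num)
    nlinarith [norm_nonneg (F 0)]
  set X := R / (R - r) * (T R + 1)
  have hX1 : 1 ≤ X := one_le_base (hT R) hr hR
  have hRr : 0 < R - r := by linarith
  have hR0 : 0 < R := by linarith
  have hqX : R / (R - r) ≤ X := by
    have h3 : 0 ≤ R / (R - r) := by apply div_nonneg <;> linarith
    nlinarith [hT R]
  have hb : Set.MapsTo F (ball 0 ((r + R) / 2)) {z | z.re ≤ C * (2 * X) ^ N} := by
    intro w hw
    rw [Set.mem_ofPred_eq, ← base_midpoint hR]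
    exact hN _ R (by linarith) (by linarith) w (by simpa using (mem_ball.1 hw).le)
  refine (Complex.borelCaratheodory (by positivity) hF.differentiableOn hb (by linarith)
    (by simp; linarith)).trans ?_
  have hden : (R - r) / 2 ≤ (r + R) / 2 - ‖z‖ := by linarith
  have e1 : 2 * (C * (2 * X) ^ N) * ‖z‖ / ((r + R) / 2 - ‖z‖) ≤ 4 * C * 2 ^ N * X ^ (N + 1) := by
    calc _ ≤ 2 * (C * (2 * X) ^ N) * R / ((R - r) / 2) := by gcongr; linarith
      _ = 4 * C * 2 ^ N * X ^ N * (R / (R - r)) := by rw [mul_pow]; field_simp; ring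
      _ ≤ 4 * C * 2 ^ N * X ^ N * X := by gcongr
      _ = _ := by ring
  have e2 : ‖F 0‖ * ((r + R) / 2 + ‖z‖) / ((r + R) / 2 - ‖z‖) ≤ 4 * ‖F 0‖ * X ^ (N + 1) := by
    calc _ ≤ ‖F 0‖ * (2 * R) / ((R - r) / 2) := by gcongr; linarith
      _ = 4 * ‖F 0‖ * (R / (R - r)) := by field_simp; ring
      _ ≤ 4 * ‖F 0‖ * X ^ (N + 1) := by
        gcongr
        exact hqX.trans (le_self_pow₀ hX1 (by omega))
  linarith

end PolyBounded

theorem eq_const_of_re_le_log {h : ℂ → ℂ} (hh : Differentiable ℂ h) {K : ℝ}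
    (hK : ∀ r : ℝ, 1 ≤ r → ∀ z, ‖z‖ ≤ r → (h z).re ≤ K * (1 + Real.log r)) (z w : ℂ) :
    h z = h w := by
  refine is_const_of_deriv_eq_zero hh (fun z => ?_) z w
  have hK0 : ∀ r : ℝ, 1 ≤ r → ∀ z, ‖z‖ ≤ r → (h z).re ≤ (|K| + 1) * (1 + Real.log r) := by
    intro r hr z hz
    refine (hK r hr z hz).trans ?_
    have := Real.log_nonneg hr
    gcongr
    linarith [le_abs_self K]
  set L := |K| + 1 with hL
  have hL0 : 0 < L := by positivity
  have hb : ∀ r : ℝ, 1 ≤ r → ‖z‖ ≤ r → ‖deriv h z‖ ≤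
      (4 * (L * (1 + (Real.log 4 + Real.log r))) + 3 * ‖h 0‖) / r := by
    intro r hr hzr
    have hlr := Real.log_nonneg hr
    have hl4 : 0 ≤ Real.log 4 := Real.log_nonneg (by norm_num)
    refine Complex.norm_deriv_le_of_forall_mem_sphere_norm_le (by linarith) hh.diffContOnCl ?_
    intro w hw
    have hw2 : ‖w‖ ≤ 2 * r := by
      have := norm_le_norm_add_norm_sub' w z
      rw [← dist_eq_norm, mem_sphere.1 hw] at this
      linarith
    have hmaps : Set.MapsTo h (ball 0 (4 * r))
        {z | z.re ≤ L * (1 + (Real.log 4 + Real.log r))} := by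
      intro x hx
      rw [Set.mem_ofPred_eq, ← Real.log_mul (by norm_num) (by linarith)]
      exact hK0 _ (by linarith) x (by simpa using (mem_ball.1 hx).le)
    refine (Complex.borelCaratheodory (by positivity) hh.differentiableOn hmaps (by linarith)
      (by simp; linarith)).trans ?_
    set B := L * (1 + (Real.log 4 + Real.log r))
    have hB : 0 < B := by positivity
    have hden : 0 < 4 * r - ‖w‖ := by linarith
    rw [← add_div, div_le_iff₀ hden]
    nlinarith [norm_nonneg (h 0), norm_nonneg w, mul_nonneg hB.le (sub_nonneg.2 hw2),
      mul_nonneg (norm_nonneg (h 0)) (sub_nonneg.2 hw2)]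
  have hlim : Tendsto (fun r : ℝ => (4 * (L * (1 + (Real.log 4 + Real.log r))) + 3 * ‖h 0‖) / r)
      atTop (𝓝 0) := by
    have h1 : Tendsto (fun r : ℝ => Real.log r / r) atTop (𝓝 0) :=
      Real.isLittleO_log_id_atTop.tendsto_div_nhds_zero
    have h2 := (tendsto_inv_atTop_zero (𝕜 := ℝ)).const_mul
      (4 * (L * (1 + Real.log 4)) + 3 * ‖h 0‖)
    have h3 := h2.add (h1.const_mul (4 * L))
    simp only [mul_zero, add_zero] at h3
    refine h3.congr fun r => ?_
    simp only [div_eq_mul_inv]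
    ring
  have hle : ‖deriv h z‖ ≤ 0 := by
    refine ge_of_tendsto hlim ?_
    filter_upwards [eventually_ge_atTop (1 : ℝ), eventually_ge_atTop ‖z‖] with r h1 h2
    exact hb r h1 h2
  exact norm_le_zero_iff.1 hle

theorem mul_deriv_eq_of_deriv_mul_exp_sub_exp_eq {h k : ℂ → ℂ} (hh : Differentiable ℂ h)
    (hk : Differentiable ℂ k) {d : ℂ}
    (heq : ∀ z, deriv h z * Complex.exp (h z) - Complex.exp (k z) = d) (z : ℂ) :
    d * deriv k z =
      (deriv h z * deriv k z - deriv (deriv h) z - deriv h z ^ 2) * Complex.exp (h z) := by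
  have h1 := ((hh.deriv z).hasDerivAt.mul (hh z).hasDerivAt.cexp).sub (hk z).hasDerivAt.cexp
  have h2 : deriv (fun z => deriv h z * Complex.exp (h z) - Complex.exp (k z)) z = 0 := by
    rw [funext heq, deriv_const]
  have h3 := h1.deriv.symm.trans h2
  linear_combination (-deriv k z) * heq z + h3

theorem exists_circleAverage_abs_re_le {h k : ℂ → ℂ} (hh : Differentiable ℂ h)
    (hk : Differentiable ℂ k) {d : ℂ} (hd : d ≠ 0)
    (heq : ∀ z, deriv h z * Complex.exp (h z) - Complex.exp (k z) = d) (hk0 : deriv k 0 ≠ 0) :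
    ∃ C : ℝ, 1 ≤ C ∧ ∀ r R : ℝ, 1 ≤ r → r < R →
      circleAverage (fun z => |(h z).re|) 0 r + 1 ≤
        C * (1 + Real.log (R / (R - r) * (circleAverage (fun z => |(h z).re|) 0 R + 1))) := by
  set T : ℝ → ℝ := circleAverage (fun z => |(h z).re|) 0 with hTdef
  have hT : ∀ R, 0 ≤ T R := fun R => circleAverage_nonneg_of_nonneg fun _ _ => abs_nonneg _
  have hh1 := hh.deriv
  have hk1 := hk.deriv
  have hre : PolyBounded T fun z => (h z).re := by
    refine ⟨2, by norm_num, 1, fun r R hr hR z hz => ?_⟩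
    refine (re_le_mul_circleAverage_abs_re hh hz hR).trans ?_
    rw [pow_one, ← mul_assoc, ← mul_div_assoc]
    have hRr : 0 < R - r := by linarith
    refine mul_le_mul ?_ (by linarith) (hT R) (div_nonneg (by linarith) hRr.le)
    gcongr
    linarith
  have bh := hre.norm_of_re hT hh
  have bh1 := bh.norm_deriv hT hh
  have bh2 := bh1.norm_deriv hT hh1
  have bk : PolyBounded T fun z => (k z).re := by
    refine PolyBounded.mono ((bh.add hT bh1).add hT (PolyBounded.const T ‖d‖)) fun z => ?_
    rw [← Real.exp_le_exp, ← Complex.norm_exp]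
    have e : Complex.exp (k z) = deriv h z * Complex.exp (h z) - d := by
      linear_combination (-1) * heq z
    rw [e, add_assoc, Real.exp_add]
    have h1 : Real.exp (h z).re ≤ Real.exp ‖h z‖ := Real.exp_le_exp.2 (Complex.re_le_norm _)
    have h2 : 1 ≤ Real.exp ‖h z‖ := Real.one_le_exp (norm_nonneg _)
    calc ‖deriv h z * Complex.exp (h z) - d‖
        ≤ ‖deriv h z‖ * Real.exp (h z).re + ‖d‖ := by
          refine (norm_sub_le _ _).trans_eq ?_
          rw [norm_mul, Complex.norm_exp]
      _ ≤ ‖deriv h z‖ * Real.exp ‖h z‖ + Real.exp ‖h z‖ * ‖d‖ :=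
          add_le_add (by gcongr) (le_mul_of_one_le_left (norm_nonneg d) h2)
      _ = Real.exp ‖h z‖ * (‖deriv h z‖ + ‖d‖) := by ring
      _ ≤ _ := by
          gcongr
          linarith [Real.add_one_le_exp (‖deriv h z‖ + ‖d‖)]
  have bk1 := (bk.norm_of_re hT hk).norm_deriv hT hk
  set G : ℂ → ℂ := fun z => deriv h z * deriv k z - deriv (deriv h) z - deriv h z ^ 2 with hG
  have hGeq : ∀ z, d * deriv k z = G z * Complex.exp (h z) :=
    mul_deriv_eq_of_deriv_mul_exp_sub_exp_eq hh hk heq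
  have bG : PolyBounded T fun z => ‖G z‖ := by
    refine PolyBounded.mono (((bh1.mul hT (fun _ => norm_nonneg _) bk1).add hT bh2).add hT
      (bh1.mul hT (fun _ => norm_nonneg _) bh1)) fun z => ?_
    refine (norm_sub_le _ _).trans (add_le_add ((norm_sub_le _ _).trans_eq ?_) ?_)
    · rw [norm_mul]
    · rw [norm_pow, sq]
  obtain ⟨C, hC, N, hN⟩ := bk1.add hT
    ((PolyBounded.const T ‖d‖⁻¹).mul hT (fun _ => norm_nonneg _) bG)
  have hlC := Real.log_nonneg hC
  refine ⟨2 * Real.log C + 2 * N + 2 * |Real.log ‖deriv k 0‖| + |(h 0).re| + 1, ?_,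
    fun r R hr hR => ?_⟩
  · have : 0 ≤ 2 * Real.log C + 2 * N + 2 * |Real.log ‖deriv k 0‖| + |(h 0).re| := by positivity
    linarith
  set X := R / (R - r) * (T R + 1)
  have hX1 : 1 ≤ X := PolyBounded.one_le_base (hT R) hr hR
  have hlX := Real.log_nonneg hX1
  have hr0 : 0 < r := by linarith
  set L := Real.log (C * X ^ N) with hL
  have hLeq : L = Real.log C + N * Real.log X := by
    rw [hL, Real.log_mul (by positivity) (by positivity), Real.log_pow]
  have hL0 : 0 ≤ L := by rw [hLeq]; positivity
  have hre_cont : Continuous fun z => (h z).re := Complex.continuous_re.comp hh.continuous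
  have hreI : CircleIntegrable (fun z => (h z).re) 0 r :=
    hre_cont.continuousOn.circleIntegrable hr0.le
  have habsI : CircleIntegrable (fun z => |(h z).re|) 0 r :=
    hre_cont.abs.continuousOn.circleIntegrable hr0.le
  have hlogI : CircleIntegrable (fun z => Real.log ‖deriv k z‖) 0 r :=
    MeromorphicOn.circleIntegrable_log_norm fun z _ => (hk1.analyticAt z).meromorphicAt
  set u : ℂ → ℝ := fun z => if deriv k z = 0 then (h z).re else |(h z).re| with hu
  have hcod : (fun z => |(h z).re|) =ᶠ[codiscreteWithin (sphere 0 |r|)] u := by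
    have h1 : deriv k ⁻¹' {0}ᶜ ∈ codiscrete ℂ :=
      AnalyticOnNhd.preimage_zero_mem_codiscrete (fun z _ => hk1.analyticAt z) hk0
    filter_upwards [codiscreteWithin_mono (Set.subset_univ _) h1] with z hz
    have hz' : deriv k z ≠ 0 := hz
    simp [hu, hz']
  have huI : CircleIntegrable u 0 r := habsI.congr_codiscreteWithin hcod
  have hconstI : CircleIntegrable (fun _ => 2 * L) (0 : ℂ) r :=
    continuousOn_const.circleIntegrable hr0.le
  have hlog2I : CircleIntegrable (fun z => (2 : ℝ) • Real.log ‖deriv k z‖) 0 r :=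
    hlogI.const_smul
  have hpt : ∀ z ∈ sphere (0 : ℂ) |r|,
      u z ≤ 2 * L - (2 : ℝ) • Real.log ‖deriv k z‖ + (h z).re := by
    intro z hz
    have hzr : ‖z‖ ≤ r := by
      rw [mem_sphere_zero_iff_norm, abs_of_pos hr0] at hz; exact hz.le
    have hb := hN r R hr hR z hzr
    by_cases hkz : deriv k z = 0
    · simp only [hu, hkz, if_true, norm_zero, Real.log_zero, smul_zero]
      linarith
    have hkp : 0 < ‖deriv k z‖ := norm_pos_iff.2 hkz
    have hdp : 0 < ‖d‖ := norm_pos_iff.2 hd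
    have hG0 : 0 ≤ ‖d‖⁻¹ * ‖G z‖ := by positivity
    have l1 : Real.log ‖deriv k z‖ ≤ L := Real.log_le_log hkp (by linarith)
    have l2 : Real.log ‖deriv k z‖ - (h z).re ≤ L := by
      have e : ‖deriv k z‖ = ‖d‖⁻¹ * ‖G z‖ * Real.exp (h z).re := by
        have := congrArg norm (hGeq z)
        rw [norm_mul, norm_mul, Complex.norm_exp] at this
        rw [mul_assoc, ← this, inv_mul_cancel_left₀ hdp.ne']
      have hGp : 0 < ‖d‖⁻¹ * ‖G z‖ := by
        refine lt_of_le_of_ne hG0 fun h0 => ?_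
        rw [← h0, zero_mul] at e
        exact hkp.ne' e
      rw [e, Real.log_mul hGp.ne' (Real.exp_pos _).ne', Real.log_exp, add_sub_cancel_right]
      exact Real.log_le_log hGp (by linarith)
    simp only [hu, hkz, if_false, smul_eq_mul]
    rcases abs_cases (h z).re with ⟨e, _⟩ | ⟨e, _⟩ <;> rw [e] <;> linarith
  have havg : T r ≤ 2 * L - 2 * circleAverage (fun z => Real.log ‖deriv k z‖) 0 r + (h 0).re := by
    rw [hTdef, circleAverage_congr_codiscreteWithin hcod hr0.ne']
    refine (circleAverage_mono huI ((hconstI.sub hlog2I).add hreI) hpt).trans_eq ?_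
    rw [circleAverage_add (hconstI.sub hlog2I) hreI, circleAverage_sub hconstI hlog2I,
      circleAverage_const, circleAverage_fun_smul, smul_eq_mul]
    congr 1
    exact InnerProductSpace.HarmonicOnNhd.circleAverage_eq
      fun z _ => (hh.analyticAt z).harmonicAt_re
  have hJ := log_norm_le_circleAverage hk1 hk0 hr0
  have a1 := neg_abs_le (Real.log ‖deriv k 0‖)
  have a2 := le_abs_self (h 0).re
  have p : 0 ≤ (2 * Real.log C + 2 * |Real.log ‖deriv k 0‖| + |(h 0).re| + 1) * Real.log X := by
    positivity
  have hN0 : (0 : ℝ) ≤ N := N.cast_nonneg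
  rw [hLeq] at havg
  nlinarith

theorem eq_const_of_deriv_mul_exp_sub_exp_eq_of_deriv_zero_ne {h k : ℂ → ℂ}
    (hh : Differentiable ℂ h) (hk : Differentiable ℂ k) {d : ℂ} (hd : d ≠ 0)
    (heq : ∀ z, deriv h z * Complex.exp (h z) - Complex.exp (k z) = d) (hk0 : deriv k 0 ≠ 0)
    (z w : ℂ) : h z = h w := by
  obtain ⟨C, hC, hCb⟩ := exists_circleAverage_abs_re_le hh hk hd heq hk0
  set T : ℝ → ℝ := circleAverage (fun z => |(h z).re|) 0
  have hT : ∀ R, 0 ≤ T R := fun R => circleAverage_nonneg_of_nonneg fun _ _ => abs_nonneg _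
  have hTc : Continuous fun r => T r + 1 :=
    (Continuous.circleAverage (Complex.continuous_re.comp hh.continuous).abs).add continuous_const
  obtain ⟨K, hK⟩ := exists_le_mul_one_add_log hTc (fun r => by linarith [hT r]) hC hCb
  have hK0 : 0 ≤ K := by
    have := hK 1 le_rfl
    rw [Real.log_one] at this
    linarith [hT 1]
  refine eq_const_of_re_le_log hh (K := 6 * K) (fun r hr z hz => ?_) z w
  refine (re_le_mul_circleAverage_abs_re hh hz (show r < 2 * r by linarith)).trans ?_
  have e : (2 * r + r) / (2 * r - r) = 3 := by
    rw [div_eq_iff (by linarith)]; ring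
  rw [e]
  have h2 := hK (2 * r) (by linarith)
  rw [Real.log_mul (by norm_num) (by linarith)] at h2
  have hl2 : Real.log 2 ≤ 1 := by linarith [Real.log_two_lt_d9]
  have hlr := Real.log_nonneg hr
  change 3 * T (2 * r) ≤ _
  nlinarith [mul_le_mul_of_nonneg_left hl2 hK0, mul_nonneg hK0 hlr]

theorem eq_const_of_deriv_mul_exp_sub_exp_eq {h k : ℂ → ℂ} (hh : Differentiable ℂ h)
    (hk : Differentiable ℂ k) {d : ℂ} (hd : d ≠ 0)
    (heq : ∀ z, deriv h z * Complex.exp (h z) - Complex.exp (k z) = d) {z₀ : ℂ}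
    (hk0 : deriv k z₀ ≠ 0) (z w : ℂ) : h z = h w := by
  have := eq_const_of_deriv_mul_exp_sub_exp_eq_of_deriv_zero_ne (h := fun z => h (z + z₀))
    (k := fun z => k (z + z₀)) (hh.comp (differentiable_id.add_const z₀))
    (hk.comp (differentiable_id.add_const z₀)) hd
    (fun z => by rw [deriv_comp_add_const]; exact heq (z + z₀))
    (by rwa [deriv_comp_add_const, zero_add]) (z - z₀) (w - z₀)
  simpa using this

/-- An entire function that omits a value, and whose derivative omits a nonzero value, is
constant. -/
theorem eq_const_of_forall_ne_of_forall_deriv_ne {f : ℂ → ℂ} (hf : Differentiable ℂ f) {c d : ℂ}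
    (hd : d ≠ 0) (hc : ∀ z, f z ≠ c) (hdf : ∀ z, deriv f z ≠ d) (z w : ℂ) : f z = f w := by
  obtain ⟨h, hh, hfh⟩ := exists_eq_exp_of_forall_ne_zero (hf.sub_const c)
    fun z => sub_ne_zero.2 (hc z)
  obtain ⟨k, hk, hfk⟩ := exists_eq_exp_of_forall_ne_zero (hf.deriv.sub_const d)
    fun z => sub_ne_zero.2 (hdf z)
  have hder : ∀ z, deriv f z = deriv h z * Complex.exp (h z) := by
    intro z
    rw [← deriv_sub_const (f := f) c, funext hfh, (hh z).hasDerivAt.cexp.deriv, mul_comm]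
  by_cases hk1 : ∀ z, deriv k z = 0
  · have hcon : ∀ z, deriv f z = deriv f 0 := by
      intro z
      rw [← sub_left_inj (a := d), hfk, hfk, is_const_of_deriv_eq_zero hk hk1 z 0]
    have hlin : ∀ z, f z - deriv f 0 * z = f 0 := by
      intro z
      have hd0 : ∀ z, HasDerivAt (fun z => f z - deriv f 0 * z) 0 z := by
        intro z
        refine ((hf z).hasDerivAt.sub ((hasDerivAt_id z).const_mul (deriv f 0))).congr_deriv ?_
        rw [hcon z, mul_one, sub_self]
      simpa using is_const_of_deriv_eq_zero (fun z => (hd0 z).differentiableAt)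
        (fun z => (hd0 z).deriv) z 0
    have hzero : deriv f 0 = 0 := by
      by_contra hne
      refine hc ((c - f 0) / deriv f 0) ?_
      have := hlin ((c - f 0) / deriv f 0)
      rw [mul_div_cancel₀ _ hne] at this
      linear_combination this
    exact is_const_of_deriv_eq_zero hf (fun z => (hcon z).trans hzero) z w
  · push Not at hk1
    obtain ⟨z₀, hz₀⟩ := hk1
    have := eq_const_of_deriv_mul_exp_sub_exp_eq hh hk hd
      (fun z => by rw [← hder, ← hfk]; ring) hz₀ z w
    rw [← sub_left_inj (a := c), hfh, hfh, this]

/-- **Theorem 1.** If `a` is entire on `ℂ`, `P` is entire on `ℂ²` and divisible by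
`(z₁ - c)(z₂ - d)` (with `d ≠ 0`) in the ring of entire functions, then every entire
solution `f` of `f' + a(z)·P(f, f') = 0` is constant. -/
theorem entire_solution_constant (a : ℂ → ℂ) (ha : Differentiable ℂ a)
    (c d : ℂ) (hd : d ≠ 0)
    (P : ℂ × ℂ → ℂ) (hP : Differentiable ℂ P)
    (hdiv : ∃ g : ℂ × ℂ → ℂ, Differentiable ℂ g ∧
      ∀ z₁ z₂ : ℂ, P (z₁, z₂) = (z₁ - c) * (z₂ - d) * g (z₁, z₂))
    (f : ℂ → ℂ) (hf : Differentiable ℂ f)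
    (heq : ∀ z : ℂ, deriv f z + a z * P (f z, deriv f z) = 0) :
    ∃ A : ℂ, ∀ z : ℂ, f z = A := by
  obtain ⟨g, hg, hPg⟩ := hdiv
  have hdf : ∀ z, deriv f z ≠ d := by
    intro z hz
    have := heq z
    rw [hPg, hz, sub_self] at this
    exact hd (by simpa using this)
  have hq : Differentiable ℂ fun z => -(a z * (deriv f z - d) * g (f z, deriv f z)) :=
    ((ha.mul (hf.deriv.sub_const d)).mul (hg.comp (hf.prodMk hf.deriv))).neg
  obtain ⟨Q, -, hQ⟩ := exists_eq_mul_exp_of_deriv_eq_mul (hf.sub_const c) hq fun z => by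
    have := heq z
    rw [hPg] at this
    rw [deriv_sub_const]
    linear_combination this
  refine ⟨f 0, fun z => ?_⟩
  by_cases h0 : f 0 = c
  · have := hQ z
    rw [h0, sub_self, zero_mul, sub_eq_zero] at this
    rw [this, h0]
  · refine eq_const_of_forall_ne_of_forall_deriv_ne hf hd (c := c) (fun w hw => ?_) hdf z 0
    have := hQ w
    rw [hw, sub_self] at this
    exact mul_ne_zero (sub_ne_zero.2 h0) (Complex.exp_ne_zero _) this.symm
end

section
/- Fix n ≥ 1 and m ≥ 1. For each multi-index I = (i₁, …, iₙ) with 1 ≤ |I| ≤ m let a_I be a polynomial on ℂⁿ, and for entire f : ℂⁿ → ℂ define Df = Σ_{1 ≤ |I| ≤ m} a_I·∂^{|I|}f/∂z₁^{i₁}⋯∂zₙ^{iₙ}. Suppose f : ℂⁿ → ℂ is an entire function such that f(z) ≠ 0 for all z ∈ ℂⁿ and Df(z) ≠ 1 for all z ∈ ℂⁿ. Then Df(z) = 0 for all z ∈ ℂⁿ. -/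
/-- Partial derivative in the `j`-th variable of a function on `ℂⁿ`. -/
noncomputable def pderiv' {n : ℕ} (j : Fin n) (f : (Fin n → ℂ) → ℂ) :
    (Fin n → ℂ) → ℂ :=
  fun z => fderiv ℂ f z (Pi.single j 1)

/-- Iterated partial derivative `∂^{|α|}f/∂z₁^{α₁}⋯∂zₙ^{αₙ}` for a multi-index `α`. -/
noncomputable def pderivMulti {n : ℕ} (α : Fin n → ℕ) (f : (Fin n → ℂ) → ℂ) :
    (Fin n → ℂ) → ℂ :=
  (List.finRange n).foldr (fun j g => (pderiv' j)^[α j] g) f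

/-- The linear partial differential operator
`Df = Σ_{1 ≤ |I| ≤ m} a_I · ∂^{|I|}f/∂z₁^{i₁}⋯∂zₙ^{iₙ}` with polynomial
coefficients `a_I`; multi-indices `I` with `1 ≤ |I| ≤ m` are encoded as
functions `Fin n → Fin (m+1)`. -/
noncomputable def Dop {n m : ℕ} (a : (Fin n → Fin (m + 1)) → MvPolynomial (Fin n) ℂ)
    (f : (Fin n → ℂ) → ℂ) : (Fin n → ℂ) → ℂ :=
  fun z => ∑ I ∈ Finset.univ.filter
      (fun I : Fin n → Fin (m + 1) => 1 ≤ ∑ j, (I j : ℕ) ∧ ∑ j, (I j : ℕ) ≤ m),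
    MvPolynomial.eval z (a I) * pderivMulti (fun j => (I j : ℕ)) f z

section EntireGrowth

open Metric Real

/-- A nowhere vanishing entire function has an entire logarithm. -/
theorem Differentiable.exists_exp_eq {E : Type*} [NormedAddCommGroup E] [NormedSpace ℂ E]
    {f : E → ℂ} (hf : Differentiable ℂ f) (h0 : ∀ z, f z ≠ 0) :
    ∃ g : E → ℂ, Differentiable ℂ g ∧ ∀ z, f z = Complex.exp (g z) := by
  let _ : NormedSpace ℝ E := NormedSpace.restrictScalars ℝ ℂ E
  have hsc : IsSimplyConnected (Set.univ : Set E) := by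
    have : ContractibleSpace (Set.univ : Set E) := (Homeomorph.Set.univ E).contractibleSpace
    exact SimplyConnectedSpace.ofContractible _
  have hloc : LocallyPathConnectedSpace E := inferInstance
  obtain ⟨g, hgc, hg⟩ := Complex.exists_continuousOn_eqOn_exp_comp hsc isOpen_univ
    hf.continuous.continuousOn (by simpa using h0)
  have hgc : Continuous g := continuousOn_univ.mp hgc
  have hexp : ∀ z, Complex.exp (g z) = f z := fun z => hg (Set.mem_univ z)
  refine ⟨g, fun z₀ => ?_, fun z => (hexp z).symm⟩
  have hdiv : DifferentiableAt ℂ (fun z => g z₀ + Complex.log (f z / f z₀)) z₀ := by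
    refine (differentiableAt_const _).add (DifferentiableAt.clog ?_ ?_)
    · simp only [div_eq_mul_inv]
      exact (hf z₀).mul_const _
    · rw [div_self (h0 z₀)]
      exact Complex.one_mem_slitPlane
  refine hdiv.congr_of_eventuallyEq ?_
  have him : Filter.Tendsto (fun z => (g z - g z₀).im) (nhds z₀) (nhds 0) := by
    have : Continuous fun z => (g z - g z₀).im := by fun_prop
    simpa using this.tendsto z₀
  filter_upwards [him.eventually (Ioo_mem_nhds (neg_lt_zero.mpr pi_pos) pi_pos)] with z hz
  rw [← hexp z, ← hexp z₀, ← Complex.exp_sub, Complex.log_exp hz.1 hz.2.le]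
  ring

/-- A Poisson-Jensen estimate: if `W * exp g = V` with `V` and `W` bounded by `exp K` on a disc,
then `Re g` is bounded above inside the disc. -/
theorem re_le_of_mul_exp_eq {g V W : ℂ → ℂ} (hg : Differentiable ℂ g) (hW : Differentiable ℂ W)
    (h : ∀ z, W z * Complex.exp (g z) = V z) (hW0 : W 0 ≠ 0) {R K : ℝ} (hR : 0 < R) (hK : 0 ≤ K)
    (hVK : ∀ z ∈ closedBall (0 : ℂ) R, ‖V z‖ ≤ exp K)
    (hWK : ∀ z ∈ closedBall (0 : ℂ) R, ‖W z‖ ≤ exp K) {w : ℂ} (hw : w ∈ ball (0 : ℂ) R) :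
    (g w).re ≤ (R + ‖w‖) / (R - ‖w‖) * (2 * K - log ‖W 0‖) := by
  have habs : |R| = R := abs_of_pos hR
  have hwR : ‖w‖ < R := by simpa using hw
  have hWan : AnalyticOnNhd ℂ W Set.univ := fun z _ => hW.analyticAt z
  have hint : CircleIntegrable (fun z => max (g z).re 0) 0 R := by
    refine ContinuousOn.circleIntegrable hR.le (Continuous.continuousOn ?_)
    have := hg.continuous
    fun_prop
  have hlog : CircleIntegrable (fun z => log ‖W z‖) 0 R :=
    MeromorphicOn.circleIntegrable_log_norm (fun z _ => (hW.analyticAt z).meromorphicAt)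
  have hcod : ∀ᶠ z in Filter.codiscreteWithin (sphere (0 : ℂ) |R|), W z ≠ 0 := by
    have h1 := hWan.eqOn_zero_or_eventually_ne_zero_of_preconnected isPreconnected_univ
    rcases h1 with h1 | h1
    · exact absurd (h1 (Set.mem_univ 0)) hW0
    · exact Filter.codiscreteWithin_mono (Set.subset_univ _) h1
  have havg : circleAverage (fun z => max (g z).re 0) 0 R ≤ 2 * K - log ‖W 0‖ := by
    have hcongr : (fun z => max (g z).re 0) =ᶠ[Filter.codiscreteWithin (sphere (0 : ℂ) |R|)]
        (fun z => if W z = 0 then 0 else max (g z).re 0) := by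
      filter_upwards [hcod] with z hz
      simp [hz]
    rw [circleAverage_congr_codiscreteWithin hcongr hR.ne']
    have hjensen : log ‖W 0‖ ≤ circleAverage (fun z => log ‖W z‖) 0 R := by
      rw [AnalyticOnNhd.circleAverage_log_norm hR.ne' (fun z _ => hW.analyticAt z) hW0]
      refine le_add_of_nonneg_left (finsum_nonneg fun u => ?_)
      by_cases hu : u ∈ closedBall (0 : ℂ) |R|
      · refine mul_nonneg ?_ ?_
        · exact_mod_cast (MeromorphicOn.AnalyticOnNhd.divisor_nonneg
            (fun z _ => hW.analyticAt z)) u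
        · rw [habs] at hu
          rcases eq_or_ne u 0 with rfl | hu0
          · simp
          · refine log_nonneg ?_
            rw [zero_sub, norm_neg, ← div_eq_mul_inv, one_le_div (norm_pos_iff.mpr hu0)]
            simpa using hu
      · simp [hu]
    calc _ ≤ circleAverage (fun z => 2 * K - log ‖W z‖) 0 R := by
          refine circleAverage_mono (hint.congr_codiscreteWithin hcongr)
            ((circleIntegrable_const _ _ _).sub hlog) fun z hz => ?_
          rw [habs] at hz
          have hz' := sphere_subset_closedBall hz
          split_ifs with hz0
          · simp [hz0, hK]
          · have hWpos : 0 < ‖W z‖ := norm_pos_iff.mpr hz0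
            have h1 : log ‖W z‖ ≤ K := (log_le_iff_le_exp hWpos).mpr (hWK z hz')
            have h2 : log ‖W z‖ + (g z).re ≤ K := by
              have h3 : ‖W z‖ * exp (g z).re ≤ exp K := by
                rw [← Complex.norm_exp, ← norm_mul, h z]
                exact hVK z hz'
              rw [← exp_le_exp, exp_add, exp_log hWpos]
              exact h3
            exact max_le (by linarith) (by linarith)
      _ = 2 * K - circleAverage (fun z => log ‖W z‖) 0 R := by
          rw [circleAverage_fun_sub (circleIntegrable_const _ _ _) hlog, circleAverage_const]
      _ ≤ _ := by linarith
  have hpois : circleAverage (fun z => ((z - 0 + (w - 0)) / (z - 0 - (w - 0))).re • g z) 0 R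
      = g w := DiffContOnCl.circleAverage_re_herglotzRieszKernel_smul' hg.diffContOnCl hw
  have hker : ContinuousOn (fun z : ℂ => ((z - 0 + (w - 0)) / (z - 0 - (w - 0))).re)
      (sphere (0 : ℂ) R) := by
    refine Complex.continuous_re.comp_continuousOn (ContinuousOn.div (by fun_prop) (by fun_prop) ?_)
    intro z hz hzw
    have : z = w := by simpa [sub_eq_zero] using hzw
    rw [this, mem_sphere_zero_iff_norm] at hz
    exact hwR.ne hz
  have hre : circleAverage (fun z => ((z - 0 + (w - 0)) / (z - 0 - (w - 0))).re * (g z).re) 0 R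
      = (g w).re := by
    have hci : CircleIntegrable
        (fun z => ((z - 0 + (w - 0)) / (z - 0 - (w - 0))).re • g z) 0 R :=
      ContinuousOn.circleIntegrable hR.le (hker.smul hg.continuous.continuousOn)
    have := Complex.reCLM.circleAverage_comp_comm hci
    rw [hpois] at this
    simpa [Function.comp_def] using this
  have hkp : ∀ z ∈ sphere (0 : ℂ) R, 0 ≤ ((z - 0 + (w - 0)) / (z - 0 - (w - 0))).re :=
    fun z hz => (le_re_herglotzRieszKernel hz hw).trans' <| div_nonneg
      (sub_nonneg.mpr (by simpa using hwR.le)) (add_nonneg hR.le (norm_nonneg _))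
  rw [← hre]
  calc _ ≤ circleAverage (fun z => ((R + ‖w‖) / (R - ‖w‖)) • max (g z).re 0) 0 R := by
        refine circleAverage_mono ?_ ?_ fun z hz => ?_
        · refine ContinuousOn.circleIntegrable hR.le (hker.mul ?_)
          exact (Complex.continuous_re.comp hg.continuous).continuousOn
        · exact hint.const_smul
        · rw [habs] at hz
          have hk := re_herglotzRieszKernel_le hz hw
          rw [sub_zero w] at hk
          calc _ ≤ ((z - 0 + (w - 0)) / (z - 0 - (w - 0))).re * max (g z).re 0 :=
                mul_le_mul_of_nonneg_left (le_max_left _ _) (hkp z hz)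
            _ ≤ _ := mul_le_mul_of_nonneg_right (by simpa using hk) (le_max_right _ _)
    _ = (R + ‖w‖) / (R - ‖w‖) * circleAverage (fun z => max (g z).re 0) 0 R := by
        rw [circleAverage_fun_smul, smul_eq_mul]
    _ ≤ _ := mul_le_mul_of_nonneg_left havg
        (div_nonneg (by positivity) (by linarith))

/-- The previous estimate turned into a bound on `g` by the Borel-Carathéodory theorem. -/
theorem norm_le_of_mul_exp_eq {g V W : ℂ → ℂ} (hg : Differentiable ℂ g) (hW : Differentiable ℂ W)
    (h : ∀ z, W z * Complex.exp (g z) = V z) (hW0 : W 0 ≠ 0) {r R K : ℝ} (hr : 0 < r) (hrR : r < R)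
    (hK : 0 ≤ K) (hVK : ∀ z ∈ closedBall (0 : ℂ) R, ‖V z‖ ≤ exp K)
    (hWK : ∀ z ∈ closedBall (0 : ℂ) R, ‖W z‖ ≤ exp K) {w : ℂ} (hw : ‖w‖ ≤ r) :
    ‖g w‖ ≤ 16 * (R / (R - r)) ^ 2 * (2 * K - log ‖W 0‖ + 1 + ‖g 0‖) := by
  have hR : 0 < R := hr.trans hrR
  have hT : 0 ≤ 2 * K - log ‖W 0‖ := by
    have := (log_le_iff_le_exp (norm_pos_iff.mpr hW0)).mpr (hWK 0 (by simp [hR.le]))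
    linarith
  set T := 2 * K - log ‖W 0‖
  set s := (r + R) / 2 with hs
  have hd : 0 < R - r := by linarith
  have hX : 1 ≤ R / (R - r) := by rw [one_le_div hd]; linarith
  set X := R / (R - r) with hXdef
  have hbc := Complex.borelCaratheodory (f := g) (R := s) (z := w) (M := 4 * X * (T + 1))
    (by positivity) hg.differentiableOn ?_ (by positivity)
    (by rw [mem_ball_zero_iff]; linarith)
  · refine hbc.trans ?_
    have h1 : ‖w‖ / (s - ‖w‖) ≤ 2 * X := by
      rw [hXdef, ← mul_div_assoc]
      rw [div_le_div_iff₀ (by linarith) hd]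
      nlinarith [norm_nonneg w]
    have h2 : (s + ‖w‖) / (s - ‖w‖) ≤ 4 * X := by
      rw [hXdef, ← mul_div_assoc]
      rw [div_le_div_iff₀ (by linarith) hd]
      nlinarith [norm_nonneg w]
    calc _ = 2 * (4 * X * (T + 1)) * (‖w‖ / (s - ‖w‖)) + ‖g 0‖ * ((s + ‖w‖) / (s - ‖w‖)) := by ring
      _ ≤ 2 * (4 * X * (T + 1)) * (2 * X) + ‖g 0‖ * (4 * X) := by gcongr
      _ ≤ _ := by nlinarith [mul_nonneg (norm_nonneg (g 0)) (by positivity : 0 ≤ X),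
          mul_nonneg (mul_nonneg (norm_nonneg (g 0)) (by positivity : 0 ≤ X)) (sub_nonneg.mpr hX)]
  · intro z hz
    have hz' : ‖z‖ < s := by simpa using hz
    have hzR : z ∈ ball (0 : ℂ) R := by rw [mem_ball_zero_iff]; linarith
    refine (re_le_of_mul_exp_eq hg hW h hW0 hR hK hVK hWK hzR).trans ?_
    have h3 : (R + ‖z‖) / (R - ‖z‖) ≤ 4 * X := by
      rw [hXdef, ← mul_div_assoc]
      rw [div_le_div_iff₀ (by linarith) hd]
      nlinarith [norm_nonneg z]
    exact mul_le_mul h3 (by linarith) hT (by positivity)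

/-- Cauchy's estimate for the directional derivatives of an entire function. -/
theorem Differentiable.norm_fderiv_apply_le {E : Type*} [NormedAddCommGroup E] [NormedSpace ℂ E]
    {V : E → ℂ} (hV : Differentiable ℂ V) (z v : E) {δ C : ℝ} (hδ : 0 < δ)
    (hC : ∀ t : ℂ, ‖t‖ = δ → ‖V (z + t • v)‖ ≤ C) : ‖fderiv ℂ V z v‖ ≤ C / δ := by
  have hline : Differentiable ℂ fun t : ℂ => V (z + t • v) := by fun_prop
  rw [← (hV z).lineDeriv_eq_fderiv]
  exact Complex.norm_deriv_le_of_forall_mem_sphere_norm_le hδ hline.diffContOnCl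
    fun t ht => hC t (mem_sphere_zero_iff_norm.mp ht)

/-- The directional derivatives of an entire function on a finite-dimensional space are entire. -/
theorem Differentiable.fderiv_apply_complex {E : Type*} [NormedAddCommGroup E] [NormedSpace ℂ E]
    [FiniteDimensional ℂ E] {V : E → ℂ} (hV : Differentiable ℂ V) (v : E) :
    Differentiable ℂ (fun z => fderiv ℂ V z v) := by
  borelize E
  borelize (E →L[ℂ] ℂ)
  have : ProperSpace E := FiniteDimensional.proper ℂ E
  have : ProperSpace (E →L[ℂ] ℂ) := FiniteDimensional.proper ℂ _
  set k : ℝ → ℂ := fun θ => _root_.deriv (circleMap 0 1) θ * (circleMap 0 1 θ ^ 2)⁻¹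
  have hk : Continuous k := by
    simp only [k, deriv_circleMap]
    refine Continuous.mul (by fun_prop) (Continuous.inv₀ (by fun_prop) fun θ => ?_)
    exact pow_ne_zero 2 (circleMap_ne_center one_ne_zero)
  have hrep : (fun z => fderiv ℂ V z v) = fun z => (2 * π * Complex.I : ℂ)⁻¹ •
      ∫ θ in (0 : ℝ)..2 * π, k θ • V (z + circleMap 0 1 θ • v) := by
    funext z
    have hline : Differentiable ℂ fun t : ℂ => V (z + t • v) := by fun_prop
    rw [← (hV z).lineDeriv_eq_fderiv, lineDeriv,
      ← Complex.two_pi_I_inv_smul_circleIntegral_sub_sq_inv_smul_of_differentiable isOpen_univ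
        (Set.subset_univ (closedBall (0 : ℂ) 1)) hline.differentiableOn (mem_ball_self one_pos)]
    simp only [circleIntegral, k, sub_zero, smul_eq_mul, mul_assoc]
  rw [hrep]
  intro z₀
  suffices hint : DifferentiableAt ℂ
      (fun z => ∫ θ in (0 : ℝ)..2 * π, k θ • V (z + circleMap 0 1 θ • v)) z₀ from
    hint.const_smul ((2 * π * Complex.I : ℂ)⁻¹)
  obtain ⟨C, hC⟩ := (isCompact_closedBall z₀ (2 + ‖v‖)).exists_bound_of_continuousOn
    hV.continuous.continuousOn
  have hC0 : 0 ≤ C := (norm_nonneg _).trans (hC z₀ (mem_closedBall_self (by positivity)))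
  have hbound : ∀ z ∈ closedBall z₀ (1 + ‖v‖), ‖fderiv ℂ V z‖ ≤ C := by
    intro z hz
    refine ContinuousLinearMap.opNorm_le_of_unit_norm hC0 fun u hu => ?_
    have := hV.norm_fderiv_apply_le z u one_pos (C := C) fun t ht => hC _ ?_
    · simpa using this
    · rw [mem_closedBall_iff_norm] at hz ⊢
      calc ‖z + t • u - z₀‖ = ‖(z - z₀) + t • u‖ := by congr 1; abel
        _ ≤ ‖z - z₀‖ + ‖t‖ * ‖u‖ := (norm_add_le _ _).trans (by rw [norm_smul])
        _ ≤ _ := by rw [ht, hu]; linarith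
  have hderiv := intervalIntegral.hasFDerivAt_integral_of_dominated_of_fderiv_le (𝕜 := ℂ)
    (μ := MeasureTheory.volume) (a := 0) (b := 2 * π) (x₀ := z₀) (s := ball z₀ 1)
    (F := fun z θ => k θ • V (z + circleMap 0 1 θ • v))
    (F' := fun z θ => k θ • fderiv ℂ V (z + circleMap 0 1 θ • v))
    (bound := fun θ => ‖k θ‖ * C) (ball_mem_nhds _ one_pos) ?_ ?_ ?_ ?_ ?_ ?_
  · exact hderiv.differentiableAt
  · refine Filter.Eventually.of_forall fun z => Continuous.aestronglyMeasurable ?_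
    exact hk.smul (hV.continuous.comp (by fun_prop))
  · refine Continuous.intervalIntegrable ?_ _ _
    exact hk.smul (hV.continuous.comp (by fun_prop))
  · refine hk.aestronglyMeasurable.smul (Measurable.aestronglyMeasurable ?_)
    exact (measurable_fderiv ℂ V).comp (Continuous.measurable (by fun_prop))
  · refine Filter.Eventually.of_forall fun θ _ z hz => ?_
    rw [norm_smul]
    refine mul_le_mul_of_nonneg_left (hbound _ ?_) (norm_nonneg _)
    rw [mem_ball_iff_norm] at hz
    rw [mem_closedBall_iff_norm]
    calc ‖z + circleMap 0 1 θ • v - z₀‖ = ‖(z - z₀) + circleMap 0 1 θ • v‖ := by congr 1; abel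
      _ ≤ ‖z - z₀‖ + ‖circleMap 0 1 θ‖ * ‖v‖ := (norm_add_le _ _).trans (by rw [norm_smul])
      _ ≤ _ := by rw [norm_circleMap_zero, abs_one]; linarith
  · exact (Continuous.mul hk.norm continuous_const).intervalIntegrable _ _
  · refine Filter.Eventually.of_forall fun θ _ z _ => ?_
    have h1 : HasFDerivAt (fun z => z + circleMap 0 1 θ • v) (ContinuousLinearMap.id ℂ E) z :=
      (hasFDerivAt_id z).add_const _
    have h2 := ((hV (z + circleMap 0 1 θ • v)).hasFDerivAt.comp z h1).const_smul (k θ)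
    rwa [ContinuousLinearMap.comp_id] at h2

section SlowGrowth

variable {E : Type*} [NormedAddCommGroup E] [NormedSpace ℂ E]

/-- The comparison scale `(1 + R) (1 + M R) (1 + 1 / (R - r))` attached to `M : ℝ → ℝ`. -/
noncomputable def growthScale (M : ℝ → ℝ) (r R : ℝ) : ℝ :=
  (1 + R) * (1 + M R) * (1 + (R - r)⁻¹)

section

variable {M : ℝ → ℝ} {r R : ℝ}

theorem le_growthScale (hM : ∀ R, 0 ≤ M R) (hr : 1 ≤ r) (hrR : r < R) :
    1 + R ≤ growthScale M r R ∧ 1 + M R ≤ growthScale M r R ∧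
      1 + (R - r)⁻¹ ≤ growthScale M r R := by
  have h1 : 0 ≤ R := by linarith
  have h2 := hM R
  have h3 : 0 ≤ (R - r)⁻¹ := inv_nonneg.mpr (by linarith)
  have h12 := mul_nonneg h1 h2
  have h13 := mul_nonneg h1 h3
  have h23 := mul_nonneg h2 h3
  have h123 := mul_nonneg h12 h3
  unfold growthScale
  refine ⟨?_, ?_, ?_⟩ <;> nlinarith

theorem one_le_growthScale (hM : ∀ R, 0 ≤ M R) (hr : 1 ≤ r) (hrR : r < R) :
    1 ≤ growthScale M r R := by
  linarith [(le_growthScale hM hr hrR).1]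

theorem growthScale_midpoint_le (hM : ∀ R, 0 ≤ M R) (hr : 1 ≤ r) (hrR : r < R) :
    growthScale M ((r + R) / 2) R ≤ 2 * growthScale M r R := by
  have h2 := hM R
  have h3 : 0 ≤ (R - r)⁻¹ := inv_nonneg.mpr (by linarith)
  have h4 : (R - (r + R) / 2)⁻¹ = 2 * (R - r)⁻¹ := by
    rw [show R - (r + R) / 2 = (R - r) / 2 by ring, inv_div]
    ring
  unfold growthScale
  rw [h4]
  calc (1 + R) * (1 + M R) * (1 + 2 * (R - r)⁻¹)
      ≤ (1 + R) * (1 + M R) * (2 * (1 + (R - r)⁻¹)) := by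
        refine mul_le_mul_of_nonneg_left (by linarith) (mul_nonneg (by linarith) (by linarith))
    _ = _ := by ring

end

/-- An entire function whose size on the balls around `c` is bounded by a power of the scale
attached to `M`. -/
def SlowGrowth (M : ℝ → ℝ) (c : E) (V : E → ℂ) : Prop :=
  Differentiable ℂ V ∧ ∃ C : ℝ, 0 ≤ C ∧ ∃ N : ℕ, ∀ r R : ℝ, 1 ≤ r → r < R →
    ∀ z : E, ‖z - c‖ ≤ r → ‖V z‖ ≤ C * growthScale M r R ^ N

namespace SlowGrowth

variable {M : ℝ → ℝ} {c : E} {V W : E → ℂ}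

theorem const (a : ℂ) : SlowGrowth M c (fun _ => a) :=
  ⟨differentiable_const a, ‖a‖, norm_nonneg a, 0, by simp⟩

theorem add (hM : ∀ R, 0 ≤ M R) (hV : SlowGrowth M c V) (hW : SlowGrowth M c W) :
    SlowGrowth M c (fun z => V z + W z) := by
  obtain ⟨hVd, C, hC, N, hV⟩ := hV
  obtain ⟨hWd, C', hC', N', hW⟩ := hW
  refine ⟨hVd.add hWd, C + C', by positivity, N + N', fun r R hr hrR z hz => ?_⟩
  have h1 := one_le_growthScale hM hr hrR
  calc ‖V z + W z‖ ≤ ‖V z‖ + ‖W z‖ := norm_add_le _ _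
    _ ≤ C * growthScale M r R ^ N + C' * growthScale M r R ^ N' :=
        add_le_add (hV r R hr hrR z hz) (hW r R hr hrR z hz)
    _ ≤ C * growthScale M r R ^ (N + N') + C' * growthScale M r R ^ (N + N') := by
        gcongr <;> first | exact h1 | omega
    _ = _ := by ring

theorem mul (hM : ∀ R, 0 ≤ M R) (hV : SlowGrowth M c V) (hW : SlowGrowth M c W) :
    SlowGrowth M c (fun z => V z * W z) := by
  obtain ⟨hVd, C, hC, N, hV⟩ := hV
  obtain ⟨hWd, C', hC', N', hW⟩ := hW
  refine ⟨hVd.mul hWd, C * C', by positivity, N + N', fun r R hr hrR z hz => ?_⟩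
  have h1 := one_le_growthScale hM hr hrR
  calc ‖V z * W z‖ = ‖V z‖ * ‖W z‖ := norm_mul _ _
    _ ≤ (C * growthScale M r R ^ N) * (C' * growthScale M r R ^ N') :=
        mul_le_mul (hV r R hr hrR z hz) (hW r R hr hrR z hz) (norm_nonneg _) (by positivity)
    _ = _ := by ring

theorem sub (hM : ∀ R, 0 ≤ M R) (hV : SlowGrowth M c V) (hW : SlowGrowth M c W) :
    SlowGrowth M c (fun z => V z - W z) := by
  simpa [sub_eq_add_neg] using hV.add hM ((const (-1)).mul hM hW)

theorem sum {ι : Type*} (hM : ∀ R, 0 ≤ M R) (s : Finset ι) {V : ι → E → ℂ}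
    (hV : ∀ i ∈ s, SlowGrowth M c (V i)) : SlowGrowth M c (fun z => ∑ i ∈ s, V i z) := by
  classical
  induction s using Finset.induction_on with
  | empty => simpa using const 0
  | insert i s hi ih =>
    simp only [Finset.sum_insert hi]
    exact (hV i (by simp)).add hM (ih fun j hj => hV j (by simp [hj]))

theorem clm (hM : ∀ R, 0 ≤ M R) (L : E →L[ℂ] ℂ) : SlowGrowth M c L := by
  refine ⟨L.differentiable, ‖L‖ * (1 + ‖c‖), by positivity, 1, fun r R hr hrR z hz => ?_⟩
  have h1 := (le_growthScale hM hr hrR).1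
  have h2 : ‖z‖ ≤ ‖z - c‖ + ‖c‖ := by simpa using norm_add_le (z - c) c
  rw [pow_one, mul_assoc]
  refine (L.le_opNorm z).trans (mul_le_mul_of_nonneg_left ?_ (norm_nonneg _))
  nlinarith [norm_nonneg c]

/-- An entire function bounded by `M` itself has slow growth. -/
theorem of_norm_le (hM : ∀ R, 0 ≤ M R) (hMm : Monotone M) {g : E → ℂ} (hg : Differentiable ℂ g)
    (hgM : ∀ z, ‖g z‖ ≤ M ‖z - c‖) : SlowGrowth M c g := by
  refine ⟨hg, 1, zero_le_one, 1, fun r R hr hrR z hz => ?_⟩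
  have h1 := (le_growthScale hM hr hrR).2.1
  have h2 := (hgM z).trans (hMm (hz.trans hrR.le))
  linarith

theorem fderiv_apply (hM : ∀ R, 0 ≤ M R) [FiniteDimensional ℂ E] (hV : SlowGrowth M c V) (v : E) :
    SlowGrowth M c (fun z => fderiv ℂ V z v) := by
  obtain ⟨hVd, C, hC, N, hV⟩ := hV
  refine ⟨hVd.fderiv_apply_complex v, 2 * (C * 2 ^ N) * (‖v‖ + 1), by positivity, N + 1,
    fun r R hr hrR z hz => ?_⟩
  have h1 := one_le_growthScale hM hr hrR
  have hd : 0 < R - r := by linarith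
  have hv : 0 < ‖v‖ + 1 := by positivity
  set δ := (R - r) / 2 / (‖v‖ + 1) with hδ
  have hδ0 : 0 < δ := by positivity
  have hcauchy := hVd.norm_fderiv_apply_le z v (C := C * growthScale M ((r + R) / 2) R ^ N) hδ0 ?_
  · refine hcauchy.trans ?_
    have h4 : growthScale M ((r + R) / 2) R ^ N ≤ (2 * growthScale M r R) ^ N := by
      refine pow_le_pow_left₀ ?_ (growthScale_midpoint_le hM hr hrR) N
      exact zero_le_one.trans (one_le_growthScale hM (by linarith) (by linarith))
    calc _ ≤ C * (2 * growthScale M r R) ^ N / δ := by gcongr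
      _ = 2 * (C * 2 ^ N) * (‖v‖ + 1) * growthScale M r R ^ N * (R - r)⁻¹ := by
          rw [hδ, mul_pow]
          field_simp
      _ ≤ 2 * (C * 2 ^ N) * (‖v‖ + 1) * growthScale M r R ^ N * growthScale M r R := by
          gcongr
          linarith [(le_growthScale hM hr hrR).2.2]
      _ = _ := by ring
  · intro t ht
    refine hV _ _ (by linarith) (by linarith) _ ?_
    calc ‖z + t • v - c‖ = ‖(z - c) + t • v‖ := by congr 1; abel
      _ ≤ ‖z - c‖ + ‖t‖ * ‖v‖ := (norm_add_le _ _).trans (by rw [norm_smul])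
      _ ≤ r + δ * (‖v‖ + 1) := by
          rw [ht]
          gcongr
          linarith
      _ = (r + R) / 2 := by
          rw [hδ]
          field_simp
          ring

/-- If the real part of an entire function is bounded by functions of slow growth, then
the function itself has slow growth. -/
theorem of_re_le (hM : ∀ R, 0 ≤ M R) {h : E → ℂ} (hh : Differentiable ℂ h)
    (hV : SlowGrowth M c V) (hW : SlowGrowth M c W) (hre : ∀ z, (h z).re ≤ ‖V z‖ + ‖W z‖) :
    SlowGrowth M c h := by
  obtain ⟨-, C, hC, N, hV⟩ := hV
  obtain ⟨-, C', hC', N', hW⟩ := hW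
  refine ⟨hh, 4 * (C * 2 ^ N + C' * 2 ^ N' + 1 + ‖h c‖), by positivity, N + N' + 2,
    fun r R hr hrR z hz => ?_⟩
  have h1 := one_le_growthScale hM hr hrR
  have hd : 0 < R - r := by linarith
  have hs1 : 1 ≤ (r + R) / 2 := by linarith
  have hs2 : (r + R) / 2 < R := by linarith
  have hmid := growthScale_midpoint_le hM hr hrR
  have hmid1 := one_le_growthScale hM hs1 hs2
  set s := (r + R) / 2 with hs
  set Λ := growthScale M r R with hΛ
  have hΛs : ∀ N : ℕ, growthScale M s R ^ N ≤ 2 ^ N * Λ ^ N := fun N => by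
    rw [← mul_pow]
    exact pow_le_pow_left₀ (by linarith) hmid N
  have hbc := Complex.borelCaratheodory (f := fun t : ℂ => h (c + t • ((‖z - c‖ : ℂ)⁻¹ • (z - c))))
    (R := s) (z := (‖z - c‖ : ℂ)) (M := (C * 2 ^ N + C' * 2 ^ N' + 1) * Λ ^ (N + N'))
    (by positivity) (Differentiable.differentiableOn (by fun_prop)) ?_ (by positivity)
    (by simp; linarith)
  · have hz0 : c + (‖z - c‖ : ℂ) • ((‖z - c‖ : ℂ)⁻¹ • (z - c)) = z := by
      rcases eq_or_ne z c with rfl | hzc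
      · simp
      · rw [smul_inv_smul₀ (by simpa [sub_eq_zero] using hzc)]
        abel
    rw [hz0] at hbc
    simp only [zero_smul, add_zero, Complex.norm_real, norm_norm] at hbc
    refine hbc.trans ?_
    have hinv : (s - ‖z - c‖)⁻¹ ≤ 2 * Λ := by
      have h2 : (s - ‖z - c‖)⁻¹ ≤ ((R - r) / 2)⁻¹ := inv_anti₀ (by positivity) (by linarith)
      rw [inv_div, div_eq_mul_inv] at h2
      linarith [(le_growthScale hM hr hrR).2.2]
    have hR := (le_growthScale hM hr hrR).1
    have hin0 : 0 ≤ (s - ‖z - c‖)⁻¹ := inv_nonneg.mpr (by linarith)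
    have h3 : ‖z - c‖ * (s - ‖z - c‖)⁻¹ ≤ Λ * (2 * Λ) :=
      mul_le_mul (by linarith) hinv hin0 (by linarith)
    have h4 : (s + ‖z - c‖) * (s - ‖z - c‖)⁻¹ ≤ (2 * Λ) * (2 * Λ) :=
      mul_le_mul (by linarith) hinv hin0 (by linarith)
    have h5 : (1 : ℝ) ≤ Λ ^ (N + N') := one_le_pow₀ h1
    calc _ = 2 * ((C * 2 ^ N + C' * 2 ^ N' + 1) * Λ ^ (N + N')) * (‖z - c‖ * (s - ‖z - c‖)⁻¹)
          + ‖h c‖ * ((s + ‖z - c‖) * (s - ‖z - c‖)⁻¹) := by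
          simp only [div_eq_mul_inv]; ring
      _ ≤ 2 * ((C * 2 ^ N + C' * 2 ^ N' + 1) * Λ ^ (N + N')) * (Λ * (2 * Λ))
          + (‖h c‖ * Λ ^ (N + N')) * ((2 * Λ) * (2 * Λ)) := by
          gcongr
          exact le_mul_of_one_le_right (norm_nonneg _) h5
      _ = _ := by ring
  · intro t ht
    have ht' : ‖t‖ < s := by simpa using ht
    have hnorm : ‖c + t • ((‖z - c‖ : ℂ)⁻¹ • (z - c)) - c‖ ≤ s := by
      rw [add_sub_cancel_left, norm_smul, norm_smul, norm_inv, Complex.norm_real, norm_norm]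
      have : ‖z - c‖⁻¹ * ‖z - c‖ ≤ 1 := inv_mul_le_one
      nlinarith [norm_nonneg t]
    have h6 : Λ ^ N ≤ Λ ^ (N + N') := pow_le_pow_right₀ h1 (by omega)
    have h7 : Λ ^ N' ≤ Λ ^ (N + N') := pow_le_pow_right₀ h1 (by omega)
    refine (hre _).trans ?_
    calc _ ≤ C * growthScale M s R ^ N + C' * growthScale M s R ^ N' :=
          add_le_add (hV s R hs1 hs2 _ hnorm) (hW s R hs1 hs2 _ hnorm)
      _ ≤ C * (2 ^ N * Λ ^ (N + N')) + C' * (2 ^ N' * Λ ^ (N + N')) := by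
          gcongr
          · exact (hΛs N).trans (by gcongr)
          · exact (hΛs N').trans (by gcongr)
      _ ≤ _ := by nlinarith [pow_nonneg (zero_le_one.trans h1) (N + N')]

end SlowGrowth

end SlowGrowth

section Liouville

/-- A monotone function controlled by the logarithm of its own scale grows at most
logarithmically. -/
theorem exists_le_log_of_le_log_growthScale {M : ℝ → ℝ} (hM : ∀ R, 0 ≤ M R) (hMm : Monotone M)
    {A : ℝ} (hA : 0 ≤ A) (h : ∀ r R, 1 ≤ r → r < R →
      M r ≤ A * (R / (R - r)) ^ 2 * (1 + log (growthScale M r R))) :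
    ∃ B : ℝ, ∀ r, 1 ≤ r → M r ≤ B * (1 + log r) := by
  set D := 16 * A + 1 with hD
  have hD1 : 1 ≤ D := by linarith
  have hl2D : 0 ≤ log (2 * D) := log_nonneg (by linarith)
  set B := 2 * D * (8 + log (2 * D)) with hB
  have hB1 : 1 ≤ B := by nlinarith [mul_nonneg (by linarith : 0 ≤ D) hl2D]
  have hlB : 0 ≤ log B := log_nonneg hB1
  have hBD : log B + 9 ≤ B / D := by
    have h1 : log B ≤ B / (2 * D) - 1 + log (2 * D) := by
      have h2 := log_le_sub_one_of_pos (show 0 < B / (2 * D) by positivity)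
      rw [log_div (by positivity) (by positivity)] at h2
      linarith
    have h3 : B / (2 * D) = 8 + log (2 * D) := by rw [hB]; field_simp
    have h4 : B / D = 2 * (B / (2 * D)) := by field_simp
    linarith
  refine ⟨B, fun r₀ hr₀ => ?_⟩
  have hr₀pos : 0 < r₀ := by linarith
  have hlr : 0 ≤ log r₀ := log_nonneg hr₀
  set L := 1 + log r₀ with hL
  have hL1 : 1 ≤ L := by linarith
  by_contra! hcon
  set ρ : ℕ → ℝ := fun k => r₀ * (2 - (1 / 2) ^ k) with hρ
  have hρ1 : ∀ k, 1 ≤ ρ k := fun k => by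
    have : (1 / 2 : ℝ) ^ k ≤ 1 := pow_le_one₀ (by norm_num) (by norm_num)
    simp only [hρ]
    nlinarith
  have hρ2 : ∀ k, ρ k ≤ 2 * r₀ := fun k => by
    have : (0 : ℝ) < (1 / 2) ^ k := by positivity
    simp only [hρ]
    nlinarith
  have hsub : ∀ k, ρ (k + 1) - ρ k = r₀ * (1 / 2) ^ (k + 1) := fun k => by
    simp only [hρ]
    ring
  have hstep : ∀ k, 1 + M (ρ k) ≤ D * 4 ^ k * (log (1 + M (ρ (k + 1))) + 5 * 4 ^ k * L) := by
    intro k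
    have hpos : 0 < ρ (k + 1) - ρ k := by rw [hsub]; positivity
    have hlt : ρ k < ρ (k + 1) := by linarith
    have hM' := hM (ρ (k + 1))
    have h1 := h _ _ (hρ1 k) hlt
    have hinv : (ρ (k + 1) - ρ k)⁻¹ ≤ 2 ^ (k + 1) := by
      rw [hsub, mul_inv, one_div, inv_pow, inv_inv]
      exact mul_le_of_le_one_left (by positivity) (inv_le_one_of_one_le₀ hr₀)
    have hratio : ρ (k + 1) / (ρ (k + 1) - ρ k) ≤ 2 ^ (k + 2) := by
      rw [div_le_iff₀ hpos, hsub]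
      calc ρ (k + 1) ≤ 2 * r₀ := hρ2 _
        _ = 2 ^ (k + 2) * (r₀ * (1 / 2) ^ (k + 1)) := by
          rw [one_div, inv_pow, pow_succ' 2 (k + 1)]
          field_simp
    have hsq : (ρ (k + 1) / (ρ (k + 1) - ρ k)) ^ 2 ≤ 16 * 4 ^ k := by
      calc _ ≤ ((2 : ℝ) ^ (k + 2)) ^ 2 :=
            pow_le_pow_left₀ (div_nonneg (by linarith [hρ1 (k + 1)]) hpos.le) hratio 2
        _ = 16 * 4 ^ k := by
          rw [← pow_mul, mul_comm, pow_mul]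
          norm_num
          ring
    have hk : (k : ℝ) + 1 ≤ 4 ^ k := by
      have := one_add_mul_le_pow (show (-2 : ℝ) ≤ 3 by norm_num) k
      norm_num at this
      nlinarith [(Nat.cast_nonneg k : (0 : ℝ) ≤ k)]
    have hl1 : log (1 + ρ (k + 1)) ≤ 1 + L := by
      have h3 : log (1 + ρ (k + 1)) ≤ log (3 * r₀) :=
        log_le_log (by linarith [hρ1 (k + 1)]) (by linarith [hρ2 (k + 1)])
      rw [log_mul (by norm_num) hr₀pos.ne'] at h3
      linarith [log_le_sub_one_of_pos (show (0 : ℝ) < 3 by norm_num)]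
    have hl2 : log (1 + (ρ (k + 1) - ρ k)⁻¹) ≤ k + 2 := by
      have h3 : log (1 + (ρ (k + 1) - ρ k)⁻¹) ≤ log (2 ^ (k + 2)) := by
        refine log_le_log (by positivity) ?_
        have : (1 : ℝ) ≤ 2 ^ (k + 1) := one_le_pow₀ (by norm_num)
        rw [pow_succ' 2 (k + 1)]
        linarith
      rw [log_pow] at h3
      push_cast at h3
      nlinarith [log_two_lt_d9, (Nat.cast_nonneg k : (0 : ℝ) ≤ k)]
    have hlog : log (growthScale M (ρ k) (ρ (k + 1))) ≤
        (1 + L) + log (1 + M (ρ (k + 1))) + (k + 2) := by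
      have hne1 : 1 + ρ (k + 1) ≠ 0 := by linarith [hρ1 (k + 1)]
      have hne2 : 1 + M (ρ (k + 1)) ≠ 0 := by linarith
      have hne3 : 1 + (ρ (k + 1) - ρ k)⁻¹ ≠ 0 := by positivity
      rw [growthScale, log_mul (mul_ne_zero hne1 hne2) hne3, log_mul hne1 hne2]
      linarith
    have hl0 : 0 ≤ log (1 + M (ρ (k + 1))) := log_nonneg (by linarith)
    have hlast : 1 + log (growthScale M (ρ k) (ρ (k + 1))) ≤
        log (1 + M (ρ (k + 1))) + 5 * 4 ^ k * L := by
      have : (1 : ℝ) ≤ 4 ^ k := one_le_pow₀ (by norm_num)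
      nlinarith
    have h4k : (1 : ℝ) ≤ 4 ^ k := one_le_pow₀ (by norm_num)
    set T := log (1 + M (ρ (k + 1))) + 5 * 4 ^ k * L with hT
    have hT1 : 1 ≤ T := by nlinarith
    have hg0 := log_nonneg (one_le_growthScale hM (hρ1 k) hlt)
    calc 1 + M (ρ k) ≤ 1 + A * (16 * 4 ^ k) * T := by
          refine add_le_add_right (h1.trans ?_) 1
          gcongr
      _ ≤ 4 ^ k * T + A * (16 * 4 ^ k) * T := by
          gcongr
          exact one_le_mul_of_one_le_of_one_le h4k hT1
      _ = D * 4 ^ k * T := by rw [hD]; ring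
  have hind : ∀ k, B * 16 ^ k * L ≤ 1 + M (ρ k) := by
    intro k
    induction k with
    | zero =>
      have : ρ 0 = r₀ := by simp only [hρ]; norm_num
      rw [this]
      linarith
    | succ k ih =>
      have hk : (k : ℝ) + 1 ≤ 4 ^ k := by
        have := one_add_mul_le_pow (show (-2 : ℝ) ≤ 3 by norm_num) k
        norm_num at this
        nlinarith [(Nat.cast_nonneg k : (0 : ℝ) ≤ k)]
      have h4k : (1 : ℝ) ≤ 4 ^ k := one_le_pow₀ (by norm_num)
      have h4L : (4 : ℝ) ^ k ≤ 4 ^ k * L := le_mul_of_one_le_right (by positivity) hL1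
      have h4L' : L ≤ 4 ^ k * L := le_mul_of_one_le_left (by positivity) h4k
      have h1 := ih.trans (hstep k)
      have h2 : B / D * 4 ^ k * L ≤ log (1 + M (ρ (k + 1))) + 5 * 4 ^ k * L := by
        have h16 : (16 : ℝ) ^ k = 4 ^ k * 4 ^ k := by rw [← mul_pow]; norm_num
        rw [h16] at h1
        refine le_of_mul_le_mul_left (le_trans (le_of_eq ?_) h1)
          (show 0 < D * 4 ^ k by positivity)
        field_simp
      have h3 : (log B + 9) * (4 ^ k * L) ≤ B / D * (4 ^ k * L) := by gcongr
      have h4 : log (B * 16 ^ (k + 1) * L) ≤ log (1 + M (ρ (k + 1))) := by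
        rw [log_mul (by positivity) (by positivity), log_mul (by positivity) (by positivity),
          log_pow]
        have h16 : log 16 ≤ 3 := by
          rw [show (16 : ℝ) = 2 ^ 4 by norm_num, log_pow]
          push_cast
          linarith [log_two_lt_d9]
        have hlL : log L ≤ L := (log_le_sub_one_of_pos (by linarith)).trans (by linarith)
        push_cast
        have h5 : ((k : ℝ) + 1) * log 16 ≤ 4 ^ k * 3 := by
          gcongr
        have h6 : log B ≤ log B * (4 ^ k * L) := le_mul_of_one_le_right hlB (by linarith)
        nlinarith
      exact (log_le_log_iff (by positivity) (by linarith [hM (ρ (k + 1))])).mp h4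
  obtain ⟨k, hk⟩ := pow_unbounded_of_one_lt (1 + M (2 * r₀)) (show (1 : ℝ) < 16 by norm_num)
  have h1 := hind k
  have h2 := hMm (hρ2 k)
  have h3 : (16 : ℝ) ^ k ≤ B * 16 ^ k * L := by
    rw [mul_right_comm]
    exact le_mul_of_one_le_left (by positivity) (one_le_mul_of_one_le_of_one_le hB1 hL1)
  linarith

variable {E : Type*} [NormedAddCommGroup E]

/-- The maximum modulus of `g` on the closed ball of radius `R` around `c`. -/
noncomputable def maxModulus (g : E → ℂ) (c : E) (R : ℝ) : ℝ :=
  ⨆ z : closedBall c R, ‖g z‖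

theorem maxModulus_nonneg (g : E → ℂ) (c : E) (R : ℝ) : 0 ≤ maxModulus g c R :=
  Real.iSup_nonneg fun _ => norm_nonneg _

theorem maxModulus_le {g : E → ℂ} {c : E} {R B : ℝ} (hB : 0 ≤ B)
    (h : ∀ z, ‖z - c‖ ≤ R → ‖g z‖ ≤ B) : maxModulus g c R ≤ B :=
  Real.iSup_le (fun z => h z (mem_closedBall_iff_norm.mp z.2)) hB

variable [NormedSpace ℂ E]

/-- An entire function of logarithmic growth has vanishing derivative. -/
theorem fderiv_apply_eq_zero_of_le_log {g : E → ℂ} (hg : Differentiable ℂ g) {c : E} {B : ℝ}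
    (h : ∀ r, 1 ≤ r → ∀ z, ‖z - c‖ ≤ r → ‖g z‖ ≤ B * (1 + log r)) (z v : E) :
    fderiv ℂ g z v = 0 := by
  set K := 1 + ‖z - c‖ + ‖v‖ with hK
  have hK1 : 1 ≤ K := by linarith [norm_nonneg (z - c), norm_nonneg v]
  have hbound : ∀ᶠ δ : ℝ in Filter.atTop,
      ‖fderiv ℂ g z v‖ ≤ B * (1 + log K) * (1 / δ) + B * (log δ / δ) := by
    filter_upwards [Filter.eventually_ge_atTop 1] with δ hδ
    have hδ0 : 0 < δ := by linarith
    have h1 := hg.norm_fderiv_apply_le z v (C := B * (1 + log (K * δ))) hδ0 fun t ht => by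
      refine h _ (one_le_mul_of_one_le_of_one_le hK1 hδ) _ ?_
      calc ‖z + t • v - c‖ = ‖(z - c) + t • v‖ := by congr 1; abel
        _ ≤ ‖z - c‖ + ‖t‖ * ‖v‖ := (norm_add_le _ _).trans (by rw [norm_smul])
        _ ≤ K * δ := by rw [ht]; nlinarith [norm_nonneg (z - c)]
    rw [log_mul (by linarith) hδ0.ne'] at h1
    refine h1.trans (le_of_eq ?_)
    field_simp
    ring
  have hlim : Filter.Tendsto (fun δ : ℝ => B * (1 + log K) * (1 / δ) + B * (log δ / δ))
      Filter.atTop (nhds 0) := by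
    have h1 : Filter.Tendsto (fun δ : ℝ => 1 / δ) Filter.atTop (nhds 0) := by
      simpa using tendsto_inv_atTop_zero (𝕜 := ℝ)
    have h2 : Filter.Tendsto (fun δ : ℝ => log δ / δ) Filter.atTop (nhds 0) := by
      simpa using Real.tendsto_pow_log_div_mul_add_atTop 1 0 1 one_ne_zero
    simpa using (h1.const_mul (B * (1 + log K))).add (h2.const_mul B)
  exact norm_le_zero_iff.mp (ge_of_tendsto hlim hbound)

section

variable [FiniteDimensional ℂ E] {g : E → ℂ}

theorem norm_le_maxModulus (hg : Continuous g) {c z : E} {R : ℝ} (hz : ‖z - c‖ ≤ R) :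
    ‖g z‖ ≤ maxModulus g c R := by
  have : ProperSpace E := FiniteDimensional.proper ℂ E
  obtain ⟨B, hB⟩ := (isCompact_closedBall c R).exists_bound_of_continuousOn hg.continuousOn
  refine le_ciSup (f := fun z : closedBall c R => ‖g z‖) ⟨B, ?_⟩
    ⟨z, mem_closedBall_iff_norm.mpr hz⟩
  rintro _ ⟨w, rfl⟩
  exact hB w w.2

theorem maxModulus_monotone (hg : Continuous g) (c : E) : Monotone (maxModulus g c) :=
  fun _ _ h => maxModulus_le (maxModulus_nonneg _ _ _)
    fun _ hz => norm_le_maxModulus hg (hz.trans h)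

/-- If `exp g` is a quotient of two entire functions that are small compared with `g`, then `g` has
vanishing derivative. -/
theorem fderiv_apply_eq_zero_of_slowGrowth (hg : Differentiable ℂ g) {c : E} {V W : E → ℂ}
    (hV : SlowGrowth (maxModulus g c) c V) (hW : SlowGrowth (maxModulus g c) c W)
    (h : ∀ z, W z * Complex.exp (g z) = V z) (hWc : W c ≠ 0) (z v : E) :
    fderiv ℂ g z v = 0 := by
  have hM := maxModulus_nonneg g c
  have hMm := maxModulus_monotone hg.continuous c
  obtain ⟨-, C, hC, N, hV⟩ := hV
  obtain ⟨hWd, C', hC', N', hW⟩ := hW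
  have hlC : 0 ≤ log (1 + C + C') := log_nonneg (by linarith)
  set A := 2 * log (1 + C + C') + 2 * (N + N') + |log ‖W c‖| + 1 + ‖g c‖ with hA
  have hA0 : 0 ≤ A := by positivity
  have hgrow : ∀ r R, 1 ≤ r → r < R → maxModulus g c r ≤
      64 * A * (R / (R - r)) ^ 2 * (1 + log (growthScale (maxModulus g c) r R)) := by
    intro r R hr hrR
    have hd : 0 < R - r := by linarith
    have hs0 : r < (r + R) / 2 := by linarith
    have hs1 : 1 ≤ (r + R) / 2 := by linarith
    have hs2 : (r + R) / 2 < R := by linarith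
    have h1 := one_le_growthScale hM hr hrR
    have hmid := growthScale_midpoint_le hM hr hrR
    have hmid1 := one_le_growthScale hM hs1 hs2
    set Λ := growthScale (maxModulus g c) r R with hΛ
    have hlΛ : 0 ≤ log Λ := log_nonneg h1
    set s := (r + R) / 2 with hs
    set Λs := growthScale (maxModulus g c) s R
    set K := log ((1 + C + C') * Λs ^ (N + N')) with hK
    have hpow : 1 ≤ Λs ^ (N + N') := one_le_pow₀ hmid1
    have hexpK : exp K = (1 + C + C') * Λs ^ (N + N') := exp_log (by positivity)
    have hK0 : 0 ≤ K := log_nonneg (one_le_mul_of_one_le_of_one_le (by linarith) hpow)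
    have hVK : ∀ z, ‖z - c‖ ≤ s → ‖V z‖ ≤ exp K := fun z hz => by
      refine (hV s R hs1 hs2 z hz).trans ?_
      rw [hexpK]
      gcongr
      · linarith
      · omega
    have hWK : ∀ z, ‖z - c‖ ≤ s → ‖W z‖ ≤ exp K := fun z hz => by
      refine (hW s R hs1 hs2 z hz).trans ?_
      rw [hexpK]
      gcongr
      · linarith
      · omega
    have hKle : K ≤ log (1 + C + C') + (N + N') * (1 + log Λ) := by
      rw [hK, log_mul (by positivity) (by positivity), log_pow]
      have h2 : log Λs ≤ 1 + log Λ := by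
        refine (log_le_log (by linarith) hmid).trans ?_
        rw [log_mul (by norm_num) (by linarith)]
        linarith [log_two_lt_d9]
      push_cast
      gcongr
    have hT : 2 * K - log ‖W c‖ + 1 + ‖g c‖ ≤ A * (1 + log Λ) := by
      have h3 := neg_abs_le (log ‖W c‖)
      have h4 : 0 ≤ (2 * log (1 + C + C') + |log ‖W c‖| + 1 + ‖g c‖) * log Λ := by positivity
      rw [hA]
      nlinarith
    have hratio : s / (s - r) ≤ 2 * (R / (R - r)) := by
      rw [← mul_div_assoc, div_le_div_iff₀ (by linarith) hd]
      nlinarith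
    refine maxModulus_le (by positivity) fun z hz => ?_
    set u := (‖z - c‖ : ℂ)⁻¹ • (z - c) with hu
    have hu1 : ‖u‖ ≤ 1 := by
      rw [hu, norm_smul, norm_inv, Complex.norm_real, norm_norm]
      exact inv_mul_le_one
    have hz0 : c + (‖z - c‖ : ℂ) • u = z := by
      rcases eq_or_ne z c with rfl | hzc
      · simp
      · rw [hu, smul_inv_smul₀ (by simpa [sub_eq_zero] using hzc)]
        abel
    have hline : ∀ t ∈ closedBall (0 : ℂ) s, ‖c + t • u - c‖ ≤ s := fun t ht => by
      rw [mem_closedBall_zero_iff] at ht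
      rw [add_sub_cancel_left, norm_smul]
      nlinarith [norm_nonneg t]
    have hmain := norm_le_of_mul_exp_eq (g := fun t : ℂ => g (c + t • u))
      (V := fun t : ℂ => V (c + t • u)) (W := fun t : ℂ => W (c + t • u)) (by fun_prop)
      (by fun_prop) (fun t => h _) (by simpa using hWc) (by linarith : 0 < r) hs0 hK0
      (fun t ht => hVK _ (hline t ht)) (fun t ht => hWK _ (hline t ht)) (w := (‖z - c‖ : ℂ))
      (by simpa using hz)
    simp only [hz0, zero_smul, add_zero] at hmain
    calc ‖g z‖ ≤ 16 * (s / (s - r)) ^ 2 * (2 * K - log ‖W c‖ + 1 + ‖g c‖) := hmain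
      _ ≤ 16 * (s / (s - r)) ^ 2 * (A * (1 + log Λ)) := by gcongr
      _ ≤ 16 * (2 * (R / (R - r))) ^ 2 * (A * (1 + log Λ)) := by
          have : 0 ≤ s / (s - r) := div_nonneg (by linarith) (by linarith)
          gcongr
      _ = _ := by ring
  obtain ⟨B, hB⟩ := exists_le_log_of_le_log_growthScale hM hMm (by positivity) hgrow
  exact fderiv_apply_eq_zero_of_le_log hg
    (fun r hr z hz => (norm_le_maxModulus hg.continuous hz).trans (hB r hr)) z v

end

end Liouville

section MulExp

variable {E : Type*} [NormedAddCommGroup E] [NormedSpace ℂ E] {g F Q : E → ℂ}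

/-- The product of `exp g` with an entire function that is small compared with `g`. -/
def IsSlowMulExp (g F : E → ℂ) : Prop :=
  ∃ Q : E → ℂ, (∀ c, SlowGrowth (maxModulus g c) c Q) ∧ F = fun z => Q z * Complex.exp (g z)

theorem fderiv_mul_cexp_apply (hQ : Differentiable ℂ Q) (hg : Differentiable ℂ g) (z v : E) :
    fderiv ℂ (fun z => Q z * Complex.exp (g z)) z v =
      (fderiv ℂ Q z v + Q z * fderiv ℂ g z v) * Complex.exp (g z) := by
  have h := (hQ z).hasFDerivAt.mul (hg z).hasFDerivAt.cexp
  rw [HasFDerivAt.fderiv (f := fun z => Q z * Complex.exp (g z)) h]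
  simp only [add_apply, smul_apply, smul_eq_mul]
  ring

theorem IsSlowMulExp.sum {ι : Type*} (s : Finset ι) {F : ι → E → ℂ}
    (hF : ∀ i ∈ s, IsSlowMulExp g (F i)) : IsSlowMulExp g (fun z => ∑ i ∈ s, F i z) := by
  choose! Q hQ hFQ using hF
  refine ⟨fun z => ∑ i ∈ s, Q i z,
    fun c => SlowGrowth.sum (maxModulus_nonneg g c) s fun i hi => hQ i hi c, ?_⟩
  funext z
  rw [Finset.sum_mul]
  exact Finset.sum_congr rfl fun i hi => by rw [hFQ i hi]

theorem IsSlowMulExp.mul_left (hQ : ∀ c, SlowGrowth (maxModulus g c) c Q)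
    (hF : IsSlowMulExp g F) : IsSlowMulExp g (fun z => Q z * F z) := by
  obtain ⟨P, hP, rfl⟩ := hF
  exact ⟨fun z => Q z * P z, fun c => (hQ c).mul (maxModulus_nonneg g c) (hP c),
    by simp only [mul_assoc]⟩

variable [FiniteDimensional ℂ E]

theorem slowGrowth_maxModulus_self (hg : Differentiable ℂ g) (c : E) :
    SlowGrowth (maxModulus g c) c g :=
  SlowGrowth.of_norm_le (maxModulus_nonneg g c) (maxModulus_monotone hg.continuous c) hg
    fun _ => norm_le_maxModulus hg.continuous le_rfl

theorem IsSlowMulExp.fderiv_apply (hg : Differentiable ℂ g) (hF : IsSlowMulExp g F) (v : E) :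
    IsSlowMulExp g (fun z => fderiv ℂ F z v) := by
  obtain ⟨Q, hQ, rfl⟩ := hF
  refine ⟨fun z => fderiv ℂ Q z v + Q z * fderiv ℂ g z v, fun c => ?_, ?_⟩
  · have hM := maxModulus_nonneg g c
    exact ((hQ c).fderiv_apply hM v).add hM
      ((hQ c).mul hM ((slowGrowth_maxModulus_self hg c).fderiv_apply hM v))
  · exact funext fun z => fderiv_mul_cexp_apply (hQ 0).1 hg z v

theorem one_add_mul_exp_le (x : ℝ) {y : ℝ} (hy : 0 ≤ y) : 1 + x * exp y ≤ exp (x + y) := by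
  rw [exp_add]
  nlinarith [add_one_le_exp x, one_le_exp hy, exp_pos y]

/-- A Picard-type theorem: if `F` is the product of `exp g` with an entire function that is small
compared with `g`, and `F` omits `1` without vanishing identically, then `g` is constant. -/
theorem IsSlowMulExp.fderiv_apply_eq_zero (hg : Differentiable ℂ g) (hF : IsSlowMulExp g F)
    (h1 : ∀ z, F z ≠ 1) {z₁ : E} (hz₁ : F z₁ ≠ 0) (z v : E) : fderiv ℂ g z v = 0 := by
  obtain ⟨P, hP, rfl⟩ := hF
  have hPd : Differentiable ℂ P := (hP 0).1
  obtain ⟨h, hh, hexp⟩ := Differentiable.exists_exp_eq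
    (f := fun z => 1 - P z * Complex.exp (g z)) (by fun_prop)
    fun z hz => h1 z (sub_eq_zero.mp hz).symm
  have hhS : ∀ c, SlowGrowth (maxModulus g c) c h := fun c => by
    refine SlowGrowth.of_re_le (maxModulus_nonneg g c) hh (hP c)
      (slowGrowth_maxModulus_self hg c) fun z => ?_
    rw [← exp_le_exp, ← Complex.norm_exp, ← hexp]
    refine le_trans ?_ (one_add_mul_exp_le _ (norm_nonneg _))
    refine (norm_sub_le _ _).trans ?_
    rw [norm_one, norm_mul]
    gcongr
    rw [Complex.norm_exp]
    exact exp_le_exp.mpr (Complex.re_le_norm _)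
  by_cases hconst : ∀ z v, fderiv ℂ h z v = 0
  · have hc : ∀ z, h z = h z₁ := fun z =>
      is_const_of_fderiv_eq_zero hh (fun w => ContinuousLinearMap.ext (hconst w)) z z₁
    refine fderiv_apply_eq_zero_of_slowGrowth hg (SlowGrowth.const (1 - Complex.exp (h z₁)))
      (hP z₁) (fun w => ?_) (left_ne_zero_of_mul hz₁) z v
    rw [← hc w, ← hexp w]
    ring
  · push Not at hconst
    obtain ⟨c, u, hcu⟩ := hconst
    have hM := maxModulus_nonneg g c
    have hhu := (hhS c).fderiv_apply hM u
    have hgu := (slowGrowth_maxModulus_self hg c).fderiv_apply hM u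
    have hW : SlowGrowth (maxModulus g c) c fun z => fderiv ℂ h z u * P z -
        (fderiv ℂ P z u + P z * fderiv ℂ g z u) :=
      (hhu.mul hM (hP c)).sub hM (((hP c).fderiv_apply hM u).add hM ((hP c).mul hM hgu))
    have hid : ∀ w, (fderiv ℂ h w u * P w - (fderiv ℂ P w u + P w * fderiv ℂ g w u)) *
        Complex.exp (g w) = fderiv ℂ h w u := fun w => by
      have h2 : fderiv ℂ (fun z => 1 - P z * Complex.exp (g z)) w u =
          -((fderiv ℂ P w u + P w * fderiv ℂ g w u) * Complex.exp (g w)) := by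
        rw [fderiv_const_sub, neg_apply, fderiv_mul_cexp_apply hPd hg]
      have h3 : fderiv ℂ (fun z => 1 - P z * Complex.exp (g z)) w u =
          Complex.exp (h w) * fderiv ℂ h w u := by
        rw [show (fun z => 1 - P z * Complex.exp (g z)) = fun z => Complex.exp (h z) from
          funext hexp, (hh w).hasFDerivAt.cexp.fderiv]
        rfl
      have h4 := hexp w
      linear_combination h3 - h2 - fderiv ℂ h w u * h4
    refine fderiv_apply_eq_zero_of_slowGrowth hg hhu hW hid (fun h0 => hcu ?_) z v
    rw [← hid c, h0, zero_mul]

end MulExp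

section PartialDerivatives

variable {n : ℕ}

theorem slowGrowth_eval {M : ℝ → ℝ} (hM : ∀ R, 0 ≤ M R) (c : Fin n → ℂ)
    (p : MvPolynomial (Fin n) ℂ) : SlowGrowth M c fun z => MvPolynomial.eval z p := by
  induction p using MvPolynomial.induction_on with
  | C a => simpa using SlowGrowth.const a
  | add p q hp hq => simpa using hp.add hM hq
  | mul_X p i hp =>
    simpa using hp.mul hM (SlowGrowth.clm hM (ContinuousLinearMap.proj (R := ℂ) i))

theorem pderivMulti_induction {p : ((Fin n → ℂ) → ℂ) → Prop} (α : Fin n → ℕ)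
    {f : (Fin n → ℂ) → ℂ} (hf : p f) (h : ∀ j F, p F → p (pderiv' j F)) :
    p (pderivMulti α f) := by
  unfold pderivMulti
  induction List.finRange n with
  | nil => exact hf
  | cons j l ih => exact Function.Iterate.rec p ih (h j) (α j)

theorem pderiv'_const (j : Fin n) (a : ℂ) : pderiv' j (fun _ => a) = 0 := by
  funext z
  simp [pderiv']

theorem pderivMulti_const {α : Fin n → ℕ} (hα : 1 ≤ ∑ j, α j) (a : ℂ) :
    pderivMulti α (fun _ => a) = 0 := by
  have hzero : ∀ (j : Fin n) (k : ℕ), (pderiv' j)^[k] (0 : (Fin n → ℂ) → ℂ) = 0 := fun j k =>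
    Function.iterate_fixed (pderiv'_const j 0) k
  have key : ∀ l : List (Fin n), (∃ j ∈ l, α j ≠ 0) →
      l.foldr (fun j g => (pderiv' j)^[α j] g) (fun _ => a) = 0 := by
    intro l
    induction l with
    | nil => simp
    | cons i l ih =>
      intro hl
      rw [List.foldr_cons]
      by_cases h : ∃ j ∈ l, α j ≠ 0
      · rw [ih h, hzero]
      · push Not at h
        have hi : α i ≠ 0 := by
          obtain ⟨j, hj, hj0⟩ := hl
          rcases List.mem_cons.mp hj with rfl | hj
          · exact hj0
          · exact absurd (h j hj) hj0
        have hl' : l.foldr (fun j g => (pderiv' j)^[α j] g) (fun _ => a) = fun _ => a := by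
          clear ih hl
          induction l with
          | nil => rfl
          | cons j l ih =>
            rw [List.foldr_cons, ih fun k hk => h k (List.mem_cons_of_mem _ hk),
              h j List.mem_cons_self, Function.iterate_zero_apply]
        obtain ⟨k, hk⟩ := Nat.exists_eq_succ_of_ne_zero hi
        rw [hl', hk, Function.iterate_succ_apply, pderiv'_const, hzero]
  refine key _ ?_
  by_contra! h
  simp [h] at hα

theorem isSlowMulExp_Dop {m : ℕ} (a : (Fin n → Fin (m + 1)) → MvPolynomial (Fin n) ℂ)
    {g : (Fin n → ℂ) → ℂ} (hg : Differentiable ℂ g) :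
    IsSlowMulExp g (Dop a fun z => Complex.exp (g z)) := by
  refine IsSlowMulExp.sum _ fun I _ => IsSlowMulExp.mul_left
    (fun c => slowGrowth_eval (maxModulus_nonneg g c) c (a I)) ?_
  exact pderivMulti_induction _ ⟨fun _ => 1, fun c => SlowGrowth.const 1, by simp⟩
    fun j F hF => hF.fderiv_apply hg _

theorem Dop_const {m : ℕ} (a : (Fin n → Fin (m + 1)) → MvPolynomial (Fin n) ℂ) (b : ℂ)
    (z : Fin n → ℂ) : Dop a (fun _ => b) z = 0 := by
  refine Finset.sum_eq_zero fun I hI => ?_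
  rw [pderivMulti_const (Finset.mem_filter.mp hI).2.1, Pi.zero_apply, mul_zero]

end PartialDerivatives

end EntireGrowth

/-- **Corollary 4.** If `f` is entire on `ℂⁿ`, `f` omits `0`, and `Df` omits `1`
(where `D` is a linear partial differential operator with polynomial coefficients
and no zeroth-order term), then `Df` is identically zero. -/
theorem Dop_eq_zero_of_omits (n m : ℕ) (hn : 1 ≤ n) (hm : 1 ≤ m)
    (aI : (Fin n → Fin (m + 1)) → MvPolynomial (Fin n) ℂ)
    (f : (Fin n → ℂ) → ℂ) (hf : Differentiable ℂ f)
    (h0 : ∀ z : Fin n → ℂ, f z ≠ 0) (h1 : ∀ z : Fin n → ℂ, Dop aI f z ≠ 1) :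
    ∀ z : Fin n → ℂ, Dop aI f z = 0 := by
  by_contra! hne
  obtain ⟨z₁, hz₁⟩ := hne
  obtain ⟨g, hg, hfg⟩ := hf.exists_exp_eq h0
  obtain rfl : f = fun z => Complex.exp (g z) := funext hfg
  have hg0 : ∀ z, fderiv ℂ g z = 0 := fun z => ContinuousLinearMap.ext
    fun v => (isSlowMulExp_Dop aI hg).fderiv_apply_eq_zero hg h1 hz₁ z v
  have hconst : (fun z => Complex.exp (g z)) = fun _ => Complex.exp (g z₁) :=
    funext fun z => by rw [is_const_of_fderiv_eq_zero hg hg0 z z₁]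
  rw [hconst] at hz₁
  exact hz₁ (Dop_const aI _ z₁)
end

section
/- Let m ≥ 1 and let f : ℂ → ℂ be an entire function such that f(z) ≠ 0 for all z ∈ ℂ and f^{(m)}(z) ≠ 1 for all z ∈ ℂ. Then f is constant. -/
open Real Set Filter Topology Metric

/-- The mean of `|Re g|` over the circle of radius `R` about the origin. -/
noncomputable def meanAbsRe (g : ℂ → ℂ) (R : ℝ) : ℝ :=
  circleAverage (fun z ↦ |(g z).re|) 0 R

/-- The quantity in powers of which entire functions on the disc of radius `r` are measured,
given a growth function `T` evaluated at a slightly larger radius `R`. -/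
noncomputable def growthGauge (T : ℝ → ℝ) (r R : ℝ) : ℝ := (2 + T R) * (2 + R) / (R - r)

/-- `F` is bounded on the disc of radius `r` by a fixed power of `growthGauge T r R`, for all
`R ∈ (r, r + 1]`. -/
def GaugeBounded (T : ℝ → ℝ) (F : ℂ → ℂ) : Prop :=
  ∃ n : ℕ, ∀ r R, 0 ≤ r → r < R → R ≤ r + 1 → ∀ z, ‖z‖ ≤ r → ‖F z‖ ≤ growthGauge T r R ^ n

lemma meanAbsRe_nonneg (g : ℂ → ℂ) (R : ℝ) : 0 ≤ meanAbsRe g R :=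
  circleAverage_nonneg_of_nonneg fun _ _ ↦ abs_nonneg _

section GaugeBounded

variable {T : ℝ → ℝ} {F G : ℂ → ℂ}

lemma four_le_growthGauge (hT : ∀ R, 0 ≤ T R) {r R : ℝ} (hr : 0 ≤ r) (hrR : r < R)
    (hR : R ≤ r + 1) :
    4 ≤ growthGauge T r R := by
  rw [growthGauge, le_div_iff₀ (by linarith)]
  nlinarith [hT R, mul_nonneg (hT R) (hr.trans hrR.le)]

lemma inv_sub_le_growthGauge (hT : ∀ R, 0 ≤ T R) {r R : ℝ} (hr : 0 ≤ r) (hrR : r < R) :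
    1 / (R - r) ≤ growthGauge T r R := by
  rw [growthGauge]
  gcongr
  nlinarith [hT R, mul_nonneg (hT R) (hr.trans hrR.le)]

lemma le_growthGauge (hT : ∀ R, 0 ≤ T R) {r R : ℝ} (hr : 0 ≤ r) (hrR : r < R) (hR : R ≤ r + 1) :
    R ≤ growthGauge T r R := by
  rw [growthGauge, le_div_iff₀ (by linarith)]
  nlinarith [hT R, mul_nonneg (hT R) (hr.trans hrR.le)]

lemma growthGauge_midpoint (r R : ℝ) : growthGauge T ((r + R) / 2) R = 2 * growthGauge T r R := by
  rw [growthGauge, growthGauge, show R - (r + R) / 2 = (R - r) / 2 by ring]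
  rw [div_div_eq_mul_div]; ring

/-- Bounds at the intermediate radius `(r + R) / 2` in terms of the gauge at `r`. -/
lemma GaugeBounded.midpoint (hT : ∀ R, 0 ≤ T R) (h : GaugeBounded T F) :
    ∃ n : ℕ, ∀ r R, 0 ≤ r → r < R → R ≤ r + 1 → ∀ z, ‖z‖ ≤ (r + R) / 2 →
      ‖F z‖ ≤ growthGauge T r R ^ n := by
  obtain ⟨n, hn⟩ := h
  refine ⟨2 * n, fun r R hr hrR hR z hz ↦ ?_⟩
  have h4 := four_le_growthGauge hT hr hrR hR
  refine (hn ((r + R) / 2) R (by linarith) (by linarith) (by linarith) z hz).trans ?_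
  rw [growthGauge_midpoint, pow_mul]
  gcongr
  nlinarith

lemma GaugeBounded.const (hT : ∀ R, 0 ≤ T R) (c : ℂ) : GaugeBounded T fun _ ↦ c := by
  obtain ⟨n, hn⟩ := pow_unbounded_of_one_lt ‖c‖ (one_lt_two : (1 : ℝ) < 2)
  refine ⟨n, fun r R hr hrR hR z _ ↦ hn.le.trans ?_⟩
  have := four_le_growthGauge hT hr hrR hR
  gcongr
  linarith

lemma GaugeBounded.add (hT : ∀ R, 0 ≤ T R) (hF : GaugeBounded T F) (hG : GaugeBounded T G) :
    GaugeBounded T fun z ↦ F z + G z := by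
  obtain ⟨m, hm⟩ := hF
  obtain ⟨n, hn⟩ := hG
  refine ⟨m + n + 1, fun r R hr hrR hR z hz ↦ ?_⟩
  have h4 := four_le_growthGauge hT hr hrR hR
  have h1 : 1 ≤ growthGauge T r R := by linarith
  calc ‖F z + G z‖ ≤ growthGauge T r R ^ m + growthGauge T r R ^ n :=
        (norm_add_le _ _).trans (add_le_add (hm r R hr hrR hR z hz) (hn r R hr hrR hR z hz))
    _ ≤ growthGauge T r R ^ (m + n) + growthGauge T r R ^ (m + n) := by
        gcongr <;> first | exact h1 | omega
    _ ≤ growthGauge T r R ^ (m + n + 1) := by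
        rw [pow_succ]
        nlinarith [pow_pos (by linarith : 0 < growthGauge T r R) (m + n)]

lemma GaugeBounded.mul (hF : GaugeBounded T F) (hG : GaugeBounded T G) :
    GaugeBounded T fun z ↦ F z * G z := by
  obtain ⟨m, hm⟩ := hF
  obtain ⟨n, hn⟩ := hG
  refine ⟨m + n, fun r R hr hrR hR z hz ↦ ?_⟩
  rw [norm_mul, pow_add]
  exact mul_le_mul (hm r R hr hrR hR z hz) (hn r R hr hrR hR z hz) (norm_nonneg _)
    ((norm_nonneg _).trans (hm r R hr hrR hR z hz))

lemma GaugeBounded.neg (hF : GaugeBounded T F) : GaugeBounded T fun z ↦ -F z := by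
  simpa [GaugeBounded] using hF

lemma GaugeBounded.sub (hT : ∀ R, 0 ≤ T R) (hF : GaugeBounded T F) (hG : GaugeBounded T G) :
    GaugeBounded T fun z ↦ F z - G z := by
  simpa [sub_eq_add_neg] using hF.add hT hG.neg

lemma GaugeBounded.deriv (hT : ∀ R, 0 ≤ T R) (hF : GaugeBounded T F) (hd : Differentiable ℂ F) :
    GaugeBounded T (deriv F) := by
  obtain ⟨n, hn⟩ := hF.midpoint hT
  refine ⟨n + 2, fun r R hr hrR hR z hz ↦ ?_⟩
  have h4 := four_le_growthGauge hT hr hrR hR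
  have hX : 0 < growthGauge T r R ^ n := by positivity
  have hδ : 0 < (R - r) / 2 := by linarith
  have hi := inv_sub_le_growthGauge hT hr hrR
  have : ‖_root_.deriv F z‖ ≤ growthGauge T r R ^ n / ((R - r) / 2) := by
    refine Complex.norm_deriv_le_of_forall_mem_sphere_norm_le hδ hd.diffContOnCl fun w hw ↦ ?_
    refine hn r R hr hrR hR w ?_
    have := norm_le_norm_add_norm_sub z w
    rw [mem_sphere, dist_eq_norm] at hw
    rw [norm_sub_rev] at this
    linarith
  calc _ ≤ _ := this
    _ = growthGauge T r R ^ n * (2 * (1 / (R - r))) := by field_simp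
    _ ≤ growthGauge T r R ^ n * growthGauge T r R ^ 2 := by gcongr; nlinarith
    _ = _ := by ring

/-- An entire function is bounded as soon as its real part is bounded above, by the
Borel–Carathéodory theorem. -/
lemma GaugeBounded.of_re_le (hT : ∀ R, 0 ≤ T R) (hd : Differentiable ℂ F)
    (hF : ∃ n : ℕ, ∀ r R, 0 ≤ r → r < R → R ≤ r + 1 → ∀ z, ‖z‖ ≤ (r + R) / 2 →
      (F z).re ≤ growthGauge T r R ^ n) : GaugeBounded T F := by
  obtain ⟨n, hn⟩ := hF
  obtain ⟨m, hm⟩ := GaugeBounded.const hT (F 0)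
  refine ⟨n + m + 4, fun r R hr hrR hR z hz ↦ ?_⟩
  have h4 := four_le_growthGauge hT hr hrR hR
  have hi := inv_sub_le_growthGauge hT hr hrR
  have hX := le_growthGauge hT hr hrR hR
  have h0 := hm r R hr hrR hR z hz
  set X := growthGauge T r R
  have hX0 : 0 < X := by linarith
  have hB := Complex.borelCaratheodory (M := X ^ n) (R := (r + R) / 2) (z := z) (by positivity)
    hd.differentiableOn (fun w hw ↦ hn r R hr hrR hR w (by simpa using (mem_ball.1 hw).le))
    (by linarith) (by simp; linarith)
  have hD : 1 / ((r + R) / 2 - ‖z‖) ≤ 2 * X := by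
    calc 1 / ((r + R) / 2 - ‖z‖) ≤ 1 / ((R - r) / 2) := by gcongr; linarith
      _ = 2 * (1 / (R - r)) := by field_simp
      _ ≤ 2 * X := by linarith
  have hD0 : 0 ≤ 1 / ((r + R) / 2 - ‖z‖) := by
    apply one_div_nonneg.2; linarith
  calc ‖F z‖ ≤ _ := hB
    _ = (2 * X ^ n * ‖z‖ + ‖F 0‖ * ((r + R) / 2 + ‖z‖)) * (1 / ((r + R) / 2 - ‖z‖)) := by ring
    _ ≤ (2 * X ^ n * X + X ^ m * (X + X)) * (2 * X) := by
        gcongr <;> linarith [norm_nonneg z]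
    _ = (X ^ n + X ^ m) * (4 * X ^ 2) := by ring
    _ ≤ (X ^ (n + m) + X ^ (n + m)) * (4 * X ^ 2) := by
        gcongr <;> linarith
    _ = X ^ (n + m) * (8 * X ^ 2) := by ring
    _ ≤ X ^ (n + m) * (X ^ 2 * X ^ 2) := by
        gcongr
        nlinarith
    _ = _ := by ring

end GaugeBounded

/-- The Poisson integral formula bounds the real part of an entire function by the mean of its
modulus over a larger circle. -/
lemma re_le_mul_meanAbsRe {g : ℂ → ℂ} (hg : Differentiable ℂ g) {R : ℝ} {w : ℂ} (hw : ‖w‖ < R) :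
    (g w).re ≤ (R + ‖w‖) / (R - ‖w‖) * meanAbsRe g R := by
  have hR : 0 < R := (norm_nonneg w).trans_lt hw
  have hwb : w ∈ ball (0 : ℂ) R := by simpa
  have hkc : ContinuousOn (Complex.re ∘ herglotzRieszKernel 0 w) (sphere 0 |R|) :=
    Complex.continuous_re.comp_continuousOn (continuousOn_herglotzRieszKernel_sphere hwb)
  have hu : Continuous fun z ↦ (g z).re := Complex.continuous_re.comp hg.continuous
  have hP := hg.diffContOnCl.circleAverage_re_herglotzRieszKernel_smul hwb
  have hci : CircleIntegrable ((Complex.re ∘ herglotzRieszKernel 0 w) • g) 0 R :=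
    (hkc.smul hg.continuous.continuousOn).circleIntegrable'
  have := Complex.reCLM.circleAverage_comp_comm hci
  rw [hP] at this
  simp only [Complex.reCLM_apply] at this
  rw [← this, meanAbsRe, ← smul_eq_mul, ← circleAverage_fun_smul]
  refine circleAverage_mono ?_ ?_ fun z hz ↦ ?_
  · exact (Complex.continuous_re.comp_continuousOn
      (hkc.smul hg.continuous.continuousOn)).circleIntegrable'
  · exact (by fun_prop : Continuous _).continuousOn.circleIntegrable'
  · rw [abs_of_pos hR] at hz
    have h1 := re_herglotzRieszKernel_le hz hwb
    have h2 := le_re_herglotzRieszKernel hz hwb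
    have h3 : 0 ≤ (R - ‖w - 0‖) / (R + ‖w - 0‖) := by
      apply div_nonneg <;> simp <;> linarith [norm_nonneg w]
    rw [← herglotzRieszKernel_def] at h1 h2
    simp only [sub_zero] at h1 h2 h3
    simp only [Function.comp_apply, Pi.smul_apply', Complex.reCLM_apply, Complex.real_smul,
      Complex.re_ofReal_mul, smul_eq_mul]
    calc _ ≤ (herglotzRieszKernel 0 w z).re * |(g z).re| := by
          gcongr
          · linarith
          · exact le_abs_self _
      _ ≤ _ := by gcongr

lemma GaugeBounded.self {g : ℂ → ℂ} (hg : Differentiable ℂ g) :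
    GaugeBounded (meanAbsRe g) g := by
  have hT := meanAbsRe_nonneg g
  refine GaugeBounded.of_re_le hT hg ⟨3, fun r R hr hrR hR z hz ↦ ?_⟩
  have h4 := four_le_growthGauge hT hr hrR hR
  refine (re_le_mul_meanAbsRe hg (by linarith : ‖z‖ < R)).trans ?_
  have hT0 := hT R
  calc (R + ‖z‖) / (R - ‖z‖) * meanAbsRe g R
      ≤ (R + R) / ((R - r) / 2) * meanAbsRe g R := by gcongr <;> linarith
    _ = 4 * (meanAbsRe g R * R / (R - r)) := by field_simp; ring
    _ ≤ 4 * growthGauge (meanAbsRe g) r R := by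
        rw [growthGauge]
        gcongr <;> linarith
    _ ≤ growthGauge (meanAbsRe g) r R ^ 3 := by
        have : 0 < growthGauge (meanAbsRe g) r R := by linarith
        nlinarith [mul_le_mul h4 h4 (by norm_num) this.le]

/-- A function growing at most logarithmically in its own values at slightly larger radii grows
at most logarithmically. -/
lemma le_log_of_le_log_growthGauge {T : ℝ → ℝ} (hT : ∀ R, 0 ≤ T R)
    (hb : ∀ r, BddAbove (T '' Icc r (r + 2))) {A : ℝ} (hA : 1 ≤ A)
    (h : ∀ r R, 1 ≤ r → r < R → R ≤ r + 1 → T r ≤ A * log (growthGauge T r R))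
    {r : ℝ} (hr : 1 ≤ r) : T r ≤ 100 * A ^ 2 * log (r + 5) := by
  by_contra! hlt
  set L := log (r + 5)
  set M := 100 * A ^ 2 with hM
  have hL : 1 ≤ L := by
    rw [Real.le_log_iff_exp_le (by linarith)]
    linarith [Real.exp_one_lt_d9]
  have hlogM : log (4 * M) ≤ 40 * A := by
    rw [show 4 * M = (20 * A) ^ 2 by rw [hM]; ring, Real.log_pow]
    have := Real.log_le_sub_one_of_pos (by positivity : 0 < 20 * A)
    push_cast
    linarith
  have hM1 : 1 ≤ M := by nlinarith
  set ρ : ℕ → ℝ := fun k ↦ r + 2 - 2 / 2 ^ k with hρ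
  have hρ1 : ∀ k, ρ k ∈ Icc r (r + 2) := by
    intro k
    have h1 : (2 : ℝ) / 2 ^ k ≤ 2 := div_le_self (by norm_num) (one_le_pow₀ (by norm_num))
    have h2 : (0 : ℝ) < 2 / 2 ^ k := by positivity
    constructor <;> simp only [hρ] <;> linarith
  have hstep : ∀ k, ρ (k + 1) - ρ k = 1 / 2 ^ k := by
    intro k
    simp only [hρ, pow_succ]
    field_simp
    ring
  have hrec : ∀ k : ℕ, T (ρ k) ≤ A * (log (2 + T (ρ (k + 1))) + L + k) := by
    intro k
    have hs := hstep k
    have hs0 : (0 : ℝ) < 1 / 2 ^ k := by positivity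
    have hs1 : (1 : ℝ) / 2 ^ k ≤ 1 := div_le_self (by norm_num) (one_le_pow₀ (by norm_num))
    refine (h (ρ k) (ρ (k + 1)) (hr.trans (hρ1 k).1) (by linarith) (by linarith)).trans ?_
    gcongr
    have hT1 := hT (ρ (k + 1))
    have hle := (hρ1 (k + 1)).2
    have hge := (hρ1 (k + 1)).1
    rw [growthGauge, hs, div_div_eq_mul_div, div_one, Real.log_mul (by nlinarith) (by positivity),
      Real.log_mul (by linarith) (by linarith), Real.log_pow]
    have h1 : log (2 + ρ (k + 1)) ≤ L := Real.log_le_log (by linarith) (by linarith)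
    have h2 : (k : ℝ) * log 2 ≤ k := by
      have := Real.log_two_lt_d9
      exact mul_le_of_le_one_right (by positivity) (by linarith)
    linarith
  have hgrow : ∀ k : ℕ, M * (L + k) < T (ρ k) := by
    intro k
    induction k with
    | zero => simpa [hρ] using hlt
    | succ k ih =>
      by_contra! hcon
      have hk : (0 : ℝ) ≤ k := by positivity
      set s := L + k with hs
      have hs1 : 1 ≤ s := by linarith
      have h1 : log (2 + T (ρ (k + 1))) ≤ 40 * A + s := by
        calc log (2 + T (ρ (k + 1))) ≤ log (4 * M * s) := by
              apply Real.log_le_log (by linarith [hT (ρ (k + 1))])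
              push_cast at hcon
              rw [← add_assoc, ← hs] at hcon
              nlinarith [mul_le_mul hM1 hs1 (by norm_num) (by linarith)]
          _ = log (4 * M) + log s := Real.log_mul (by positivity) (by positivity)
          _ ≤ _ := by
              linarith [Real.log_le_sub_one_of_pos (by positivity : 0 < s)]
      have h2 : M * s < A * (40 * A + s + s) := by
        refine ih.trans_le ((hrec k).trans (mul_le_mul_of_nonneg_left ?_ (by linarith)))
        linarith
      have h3 : A * s ≤ A ^ 2 * s := by gcongr; nlinarith
      have h4 : A ^ 2 ≤ A ^ 2 * s := le_mul_of_one_le_right (by positivity) hs1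
      rw [hM] at h2
      nlinarith
  obtain ⟨C, hC⟩ := hb r
  obtain ⟨k, hk⟩ := exists_nat_gt C
  have h1 : T (ρ k) ≤ C := hC (mem_image_of_mem T (hρ1 k))
  have h2 : (k : ℝ) ≤ M * (L + k) := by
    nlinarith [mul_nonneg (by linarith : 0 ≤ M - 1) (by positivity : (0 : ℝ) ≤ k)]
  linarith [hgrow k]

/-- Jensen's inequality: the means of `log |F|` over circles of radius at least one are bounded
below. -/
lemma exists_le_circleAverage_log_norm {F : ℂ → ℂ} (hF : Differentiable ℂ F) :
    ∃ c, ∀ r, 1 ≤ r → c ≤ circleAverage (fun z ↦ log ‖F z‖) 0 r := by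
  refine ⟨log ‖meromorphicTrailingCoeffAt F 0‖, fun r hr ↦ ?_⟩
  have hr0 : 0 < r := by linarith
  have han : AnalyticOnNhd ℂ F (closedBall 0 |r|) := fun z _ ↦ hF.analyticAt z
  rw [han.meromorphicOn.circleAverage_log_norm hr0.ne']
  have hdiv : ∀ u, (0 : ℝ) ≤ MeromorphicOn.divisor F (closedBall 0 |r|) u := fun u ↦
    mod_cast MeromorphicOn.AnalyticOnNhd.divisor_nonneg han u
  have h1 := mul_nonneg (hdiv 0) (Real.log_nonneg hr)
  have h2 : 0 ≤ ∑ᶠ u, MeromorphicOn.divisor F (closedBall 0 |r|) u * log (r * ‖0 - u‖⁻¹) := by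
    refine finsum_nonneg fun u ↦ ?_
    by_cases hu : u ∈ closedBall (0 : ℂ) |r|
    · refine mul_nonneg (hdiv u) ?_
      rcases eq_or_ne u 0 with rfl | hu0
      · simp
      · apply Real.log_nonneg
        have : 0 < ‖u‖ := norm_pos_iff.2 hu0
        rw [zero_sub, norm_neg, ← div_eq_mul_inv, one_le_div this]
        simpa [abs_of_pos hr0] using hu
    · simp [hu]
  linarith

/-- An entire function with mean absolute real part growing logarithmically is constant. -/
lemma eq_const_of_meanAbsRe_le_log {g : ℂ → ℂ} (hg : Differentiable ℂ g) {C : ℝ}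
    (h : ∀ r, 1 ≤ r → meanAbsRe g r ≤ C * log (r + 5)) (z w : ℂ) : g z = g w := by
  have hC : 0 ≤ C := by
    have h1 := (meanAbsRe_nonneg g 1).trans (h 1 le_rfl)
    exact nonneg_of_mul_nonneg_left h1 (Real.log_pos (by norm_num))
  have hbound : ∀ r, 1 ≤ r → ∀ w, ‖w‖ ≤ r →
      ‖g w‖ ≤ 10 * (C * log (3 * r + 5)) + (2 + 3 * ‖g 0‖) := by
    intro r hr w hw
    set M := 5 * (C * log (3 * r + 5)) + 1 with hM
    have hl : 0 ≤ log (3 * r + 5) := Real.log_nonneg (by linarith)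
    have hM0 : 0 < M := by positivity
    have hB := Complex.borelCaratheodory (M := M) (R := 2 * r) (z := w) hM0
      hg.differentiableOn ?_ (by linarith) (by simp; linarith)
    · refine hB.trans ?_
      have h1 : 2 * M * ‖w‖ / (2 * r - ‖w‖) ≤ 2 * M := by
        rw [div_le_iff₀ (by linarith)]; gcongr; linarith
      have h2 : ‖g 0‖ * (2 * r + ‖w‖) / (2 * r - ‖w‖) ≤ 3 * ‖g 0‖ := by
        rw [div_le_iff₀ (by linarith)]; nlinarith [norm_nonneg (g 0)]
      linarith
    · intro v hv
      have hv' : ‖v‖ < 2 * r := by simpa using hv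
      have h3 := re_le_mul_meanAbsRe hg (R := 3 * r) (w := v) (by linarith)
      have h4 := h (3 * r) (by linarith)
      have h5 : (3 * r + ‖v‖) / (3 * r - ‖v‖) ≤ 5 := by
        rw [div_le_iff₀ (by linarith)]; linarith
      have h6 := mul_le_mul h5 h4 (meanAbsRe_nonneg _ _) (by norm_num)
      change (g v).re ≤ M
      linarith
  refine is_const_of_deriv_eq_zero hg (fun z ↦ ?_) z w
  rw [← norm_le_zero_iff]
  have hlim : Tendsto (fun x : ℝ ↦ (10 * (C * log x) + (2 + 3 * ‖g 0‖)) * (6 / x))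
      atTop (𝓝 0) := by
    have h1 : Tendsto (fun x : ℝ ↦ log x / x) atTop (𝓝 0) := by
      simpa using Real.isLittleO_log_id_atTop.tendsto_div_nhds_zero
    have h2 : Tendsto (fun x : ℝ ↦ x⁻¹) atTop (𝓝 0) := tendsto_inv_atTop_zero
    have := (h1.const_mul (60 * C)).add (h2.const_mul (6 * (2 + 3 * ‖g 0‖)))
    simp only [mul_zero, add_zero] at this
    refine this.congr fun x ↦ ?_
    ring
  refine ge_of_tendsto hlim ?_
  filter_upwards [eventually_ge_atTop (6 * ‖z‖ + 11)] with x hx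
  have hz := norm_nonneg z
  have hx0 : 0 < x := by linarith
  refine (Complex.norm_deriv_le_of_forall_mem_sphere_norm_le (R := x / 6) (by positivity)
    hg.diffContOnCl fun v hv ↦ hbound ((x - 5) / 3) (by linarith) v ?_).trans_eq ?_
  · have := norm_le_norm_add_norm_sub z v
    rw [mem_sphere, dist_eq_norm] at hv
    rw [norm_sub_rev] at this
    linarith
  · rw [show 3 * ((x - 5) / 3) + 5 = x by ring]
    field_simp

/-- If `F = G * exp g` for entire functions of controlled growth, with `F` not identically zero,
then `g` is constant. -/
lemma eq_const_of_eq_mul_exp {g F G : ℂ → ℂ} (hg : Differentiable ℂ g) (hF : Differentiable ℂ F)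
    (hFb : GaugeBounded (meanAbsRe g) F) (hGb : GaugeBounded (meanAbsRe g) G)
    (h : ∀ z, F z = G z * Complex.exp (g z)) {a : ℂ} (ha : F a ≠ 0) (z w : ℂ) : g z = g w := by
  have hT := meanAbsRe_nonneg g
  obtain ⟨c, hc⟩ := exists_le_circleAverage_log_norm hF
  obtain ⟨m, hm⟩ := hFb
  obtain ⟨n, hn⟩ := hGb
  have hure : Continuous fun z ↦ (g z).re := Complex.continuous_re.comp hg.continuous
  have hmean : ∀ r, circleAverage (fun z ↦ (g z).re) 0 r = (g 0).re := by
    intro r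
    have h1 := Complex.reCLM.circleAverage_comp_comm (f := g) (c := 0) (R := r)
      hg.continuous.continuousOn.circleIntegrable'
    rw [(hg.diffContOnCl (s := ball 0 |r|)).circleAverage] at h1
    exact h1
  have hmain : ∀ r R, 1 ≤ r → r < R → R ≤ r + 1 →
      meanAbsRe g r ≤ (1 + |(g 0).re| + 2 * (m + n) + 2 * |c|) *
        log (growthGauge (meanAbsRe g) r R) := by
    intro r R hr hrR hR
    have h4 := four_le_growthGauge hT (by linarith) hrR hR
    have hm' := hm r R (by linarith) hrR hR
    have hn' := hn r R (by linarith) hrR hR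
    set X := growthGauge (meanAbsRe g) r R
    have hlX : 1 ≤ log X := by
      rw [Real.le_log_iff_exp_le (by linarith)]
      linarith [Real.exp_one_lt_d9]
    have hcF : CircleIntegrable (fun z ↦ log ‖F z‖) 0 r :=
      MeromorphicOn.circleIntegrable_log_norm fun z _ ↦ (hF.analyticAt z).meromorphicAt
    have hcu : CircleIntegrable (fun z ↦ (g z).re) 0 r :=
      hure.continuousOn.circleIntegrable'
    have hcc : CircleIntegrable (fun _ ↦ 2 * (m + n) * log X) (0 : ℂ) r :=
      continuousOn_const.circleIntegrable'
    set V : ℂ → ℝ := fun z ↦ ((g z).re + 2 * (m + n) * log X) - (2 : ℝ) • log ‖F z‖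
    have hcF2 : CircleIntegrable (fun z ↦ (2 : ℝ) • log ‖F z‖) 0 r := hcF.const_smul
    have hcV : CircleIntegrable V 0 r := (hcu.add hcc).sub hcF2
    have hV : circleAverage V 0 r = (g 0).re + 2 * (m + n) * log X
        - 2 * circleAverage (fun z ↦ log ‖F z‖) 0 r := by
      have hcs : CircleIntegrable (fun z ↦ (g z).re + 2 * (m + n) * log X) 0 r := hcu.add hcc
      rw [circleAverage_fun_sub hcs hcF2, circleAverage_fun_add hcu hcc, hmean,
        circleAverage_const, circleAverage_fun_smul, smul_eq_mul]
    have hpt : ∀ z, ‖z‖ ≤ r → F z ≠ 0 → |(g z).re| ≤ V z := by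
      intro z hz hFz
      have hGz : G z ≠ 0 := fun h0 ↦ hFz (by rw [h, h0, zero_mul])
      have h1 : log ‖F z‖ ≤ m * log X := by
        rw [← Real.log_pow]
        exact Real.log_le_log (norm_pos_iff.2 hFz) (hm' z hz)
      have h2 : log ‖G z‖ ≤ n * log X := by
        rw [← Real.log_pow]
        exact Real.log_le_log (norm_pos_iff.2 hGz) (hn' z hz)
      have h3 : log ‖F z‖ = log ‖G z‖ + (g z).re := by
        rw [h, norm_mul, Complex.norm_exp, Real.log_mul (norm_ne_zero_iff.2 hGz)
          (Real.exp_ne_zero _), Real.log_exp]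
      have h4 : (0 : ℝ) ≤ m * log X := by positivity
      have h5 : (0 : ℝ) ≤ n * log X := by positivity
      simp only [V, smul_eq_mul]
      rw [abs_le']
      constructor <;> linarith
    have hle : meanAbsRe g r ≤ circleAverage V 0 r := by
      have hcabs : CircleIntegrable (fun z ↦ |(g z).re|) 0 r :=
        hure.abs.continuousOn.circleIntegrable'
      have hev : (fun z ↦ |(g z).re|) =ᶠ[codiscreteWithin (sphere (0 : ℂ) |r|)]
          fun z ↦ min |(g z).re| (V z) := by
        have h1 := AnalyticOnNhd.preimage_zero_mem_codiscrete
          (fun z _ ↦ hF.analyticAt z : AnalyticOnNhd ℂ F univ) ha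
        filter_upwards [codiscreteWithin_mono (subset_univ _) h1, self_mem_codiscreteWithin _]
          with z hz1 hz2
        rw [min_eq_left]
        refine hpt z ?_ (by simpa using hz1)
        simpa [abs_of_pos (by linarith : 0 < r)] using (mem_sphere.1 hz2).le
      rw [meanAbsRe, circleAverage_congr_codiscreteWithin hev (by linarith)]
      refine circleAverage_mono ?_ hcV fun z _ ↦ min_le_right _ _
      exact ⟨hcabs.1.inf hcV.1, hcabs.2.inf hcV.2⟩
    rw [hV] at hle
    have h1 := hc r hr
    have h2 : (|(g 0).re| + 2 * |c|) * 1 ≤ (|(g 0).re| + 2 * |c|) * log X := by gcongr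
    linarith [le_abs_self (g 0).re, neg_abs_le c]
  refine eq_const_of_meanAbsRe_le_log hg (fun r hr ↦
    le_log_of_le_log_growthGauge hT (fun r ↦ ?_) ?_ hmain hr) z w
  · refine (isCompact_Icc.image ?_).bddAbove
    exact Continuous.circleAverage (f := fun z ↦ |(g z).re|) hure.abs
  · have : (0 : ℝ) ≤ |(g 0).re| + 2 * (m + n) + 2 * |c| := by positivity
    linarith

/-- Every entire function without zeros is the exponential of an entire function. -/
lemma exists_eq_exp {f : ℂ → ℂ} (hf : Differentiable ℂ f) (h0 : ∀ z, f z ≠ 0) :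
    ∃ g : ℂ → ℂ, Differentiable ℂ g ∧ ∀ z, f z = Complex.exp (g z) := by
  have hd : Differentiable ℂ fun z ↦ deriv f z / f z := hf.deriv.div hf h0
  obtain ⟨g, hg0, hg⟩ := hd.isExactOn_univ.with_val_at 0 (Complex.log (f 0))
  have hg' : Differentiable ℂ g := fun z ↦ (hg z (mem_univ z)).differentiableAt
  refine ⟨g, hg', fun z ↦ ?_⟩
  have hconst := is_const_of_deriv_eq_zero (f := fun z ↦ f z * Complex.exp (-g z))
    (hf.mul hg'.neg.cexp) (fun z ↦ ?_) z 0
  · simp only [hg0, Complex.exp_neg, Complex.exp_log (h0 0), mul_inv_cancel₀ (h0 0)] at hconst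
    exact (mul_inv_eq_one₀ (Complex.exp_ne_zero _)).1 hconst
  · have := (hf z).hasDerivAt.fun_mul (hg z (mem_univ z)).fun_neg.cexp
    rw [this.deriv]
    field_simp [h0 z]
    ring

/-- The derivatives of `exp g` are multiples of `exp g` by entire functions of controlled
growth. -/
lemma exists_iteratedDeriv_exp_eq {g : ℂ → ℂ} (hg : Differentiable ℂ g) (k : ℕ) :
    ∃ P : ℂ → ℂ, Differentiable ℂ P ∧ GaugeBounded (meanAbsRe g) P ∧
      ∀ z, iteratedDeriv k (fun z ↦ Complex.exp (g z)) z = P z * Complex.exp (g z) := by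
  have hT := meanAbsRe_nonneg g
  induction k with
  | zero => exact ⟨fun _ ↦ 1, by fun_prop, .const hT 1, by simp⟩
  | succ k ih =>
    obtain ⟨P, hP, hPb, hPe⟩ := ih
    refine ⟨fun z ↦ deriv P z + P z * deriv g z, hP.deriv.add (hP.mul hg.deriv),
      (hPb.deriv hT hP).add hT (hPb.mul ((GaugeBounded.self hg).deriv hT hg)), fun z ↦ ?_⟩
    rw [iteratedDeriv_succ, funext hPe]
    rw [((hP z).hasDerivAt.fun_mul (hg z).hasDerivAt.cexp).deriv]
    ring

/-- If some derivative of `exp g` vanishes identically, then `g` is constant. -/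
lemma eq_const_of_iteratedDeriv_exp_eq_zero {g : ℂ → ℂ} (hg : Differentiable ℂ g) {k : ℕ}
    (hk : ∀ z, iteratedDeriv k (fun z ↦ Complex.exp (g z)) z = 0) (z w : ℂ) : g z = g w := by
  classical
  have hex : ∃ k, ∀ z, iteratedDeriv k (fun z ↦ Complex.exp (g z)) z = 0 := ⟨k, hk⟩
  have hj := Nat.find_spec hex
  have hmin := fun i ↦ Nat.find_min hex (m := i)
  rcases hfind : Nat.find hex with _ | j
  · rw [hfind] at hj
    simpa using hj 0
  · rw [hfind] at hj hmin
    obtain ⟨a, ha⟩ := not_forall.1 (hmin j j.lt_succ_self)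
    obtain ⟨P, hP, hPb, hPe⟩ := exists_iteratedDeriv_exp_eq hg j
    have hd : Differentiable ℂ (iteratedDeriv j fun z ↦ Complex.exp (g z)) := by
      rw [funext hPe]
      exact hP.mul hg.cexp
    have hc : ∀ z, iteratedDeriv j (fun z ↦ Complex.exp (g z)) z =
        iteratedDeriv j (fun z ↦ Complex.exp (g z)) a := fun z ↦
      is_const_of_deriv_eq_zero hd (fun z ↦ by rw [← iteratedDeriv_succ]; exact hj z) z a
    exact eq_const_of_eq_mul_exp hg (differentiable_const _)
      (.const (meanAbsRe_nonneg g) _) hPb (fun z ↦ by rw [← hPe, hc z]) (a := a) ha z w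

/-- Example (i): an entire function `f` omitting `0` whose `m`-th derivative
(`m ≥ 1`) omits `1` must be constant. -/
theorem polya_saxer_millioux_higher (m : ℕ) (hm : 1 ≤ m)
    (f : ℂ → ℂ) (hf : Differentiable ℂ f)
    (h0 : ∀ z : ℂ, f z ≠ 0) (h1 : ∀ z : ℂ, iteratedDeriv m f z ≠ 1) :
    ∃ A : ℂ, ∀ z : ℂ, f z = A := by
  obtain ⟨g, hg, hfg⟩ := exists_eq_exp hf h0
  obtain rfl : f = fun z ↦ Complex.exp (g z) := funext hfg
  suffices h : ∀ z, g z = g 0 from ⟨Complex.exp (g 0), fun z ↦ congrArg Complex.exp (h z)⟩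
  have hT := meanAbsRe_nonneg g
  obtain ⟨P, hP, hPb, hPe⟩ := exists_iteratedDeriv_exp_eq hg m
  have hgb := GaugeBounded.self hg
  have hd : Differentiable ℂ fun z ↦ P z * Complex.exp (g z) - 1 :=
    (hP.mul hg.cexp).sub_const 1
  obtain ⟨φ, hφ, hφe⟩ := exists_eq_exp hd fun z hz ↦ h1 z (by rw [hPe, sub_eq_zero.1 hz])
  have hφb : GaugeBounded (meanAbsRe g) φ := by
    refine GaugeBounded.of_re_le hT hφ ?_
    obtain ⟨i, hi⟩ := hPb.midpoint hT
    obtain ⟨j, hj⟩ := hgb.midpoint hT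
    refine ⟨i + j + 1, fun r R hr hrR hR z hz ↦ ?_⟩
    have h4 := four_le_growthGauge hT hr hrR hR
    have hPz := hi r R hr hrR hR z hz
    have hgz := hj r R hr hrR hR z hz
    set X := growthGauge (meanAbsRe g) r R
    have hX : 1 ≤ X := by linarith
    have hre : (φ z).re ≤ ‖P z‖ + ‖g z‖ := by
      rw [← Real.exp_le_exp, ← Complex.norm_exp, ← hφe, Real.exp_add]
      have hE : Real.exp (g z).re ≤ Real.exp ‖g z‖ := Real.exp_le_exp.2 (Complex.re_le_norm _)
      calc ‖P z * Complex.exp (g z) - 1‖ ≤ ‖P z‖ * Real.exp (g z).re + 1 := by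
            simpa [Complex.norm_exp] using norm_sub_le (P z * Complex.exp (g z)) 1
        _ ≤ ‖P z‖ * Real.exp ‖g z‖ + Real.exp ‖g z‖ := by
            gcongr
            exact Real.one_le_exp (norm_nonneg _)
        _ = (‖P z‖ + 1) * Real.exp ‖g z‖ := by ring
        _ ≤ _ := by
            gcongr
            exact Real.add_one_le_exp _
    calc (φ z).re ≤ X ^ i + X ^ j := by linarith
      _ ≤ X ^ (i + j) + X ^ (i + j) := by
          gcongr <;> first | exact hX | omega
      _ ≤ X ^ (i + j + 1) := by
          rw [pow_succ]
          nlinarith [pow_pos (by linarith : 0 < X) (i + j)]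
  have hder : ∀ z, (deriv P z + P z * deriv g z) * Complex.exp (g z) =
      deriv φ z * (P z * Complex.exp (g z) - 1) := by
    intro z
    have hl := ((hP z).hasDerivAt.fun_mul (hg z).hasDerivAt.cexp).sub_const 1
    have hr := (hφ z).hasDerivAt.cexp
    rw [← funext hφe] at hr
    have := hl.unique hr
    rw [← hφe] at this
    linear_combination this
  by_cases hz : ∀ z, deriv φ z = 0
  · refine fun z ↦ eq_const_of_iteratedDeriv_exp_eq_zero hg (k := m + 1) (fun z ↦ ?_) z 0
    rw [iteratedDeriv_succ, funext hPe, ((hP z).hasDerivAt.fun_mul (hg z).hasDerivAt.cexp).deriv]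
    linear_combination hder z + (P z * Complex.exp (g z) - 1) * hz z
  · obtain ⟨a, ha⟩ := not_forall.1 hz
    have hPd := hPb.deriv hT hP
    have hφd := hφb.deriv hT hφ
    exact fun z ↦ eq_const_of_eq_mul_exp hg hφ.deriv hφd
      (((hφd.mul hPb).sub hT hPd).sub hT (hPb.mul (hgb.deriv hT hg)))
      (fun z ↦ by linear_combination hder z) ha z 0
end
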